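/- arXiv:1407.8465 — 4 statements merged into one kernel-verified Lean document; each statement's English description precedes it below -/
import Mathlib

section
/- Let p > 3 be a prime and let a be a rational number whose denominator is coprime to p. Then (2a-1)·Σ_{k=0}^{p-1} C(-a,k)·C(a-1,k)·H_k^{(2)}/(2k+1) ≡ B_{p-2}(a) (mod p). -/
open Finset

/-- Generalized binomial coefficient `C(a,k) = a(a-1)⋯(a-k+1)/k!` for a rational `a`. -/
noncomputable def gchoose (a : ℚ) (k : ℕ) : ℚ :=
  (∏ j ∈ Finset.range k, (a - j)) / (Nat.factorial k : ℚ)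

/-- The harmonic number `H_k = ∑_{j=1}^k 1/j`. -/
def harm (k : ℕ) : ℚ := ∑ j ∈ Finset.range k, (1 : ℚ) / (j + 1)

/-- The second-order harmonic number `H_k^{(2)} = ∑_{j=1}^k 1/j²`. -/
def harm2 (k : ℕ) : ℚ := ∑ j ∈ Finset.range k, (1 : ℚ) / (j + 1) ^ 2

/-- `x ≡ y (mod p^m)` for rationals: the p-adic valuation of `x - y` is at least `m`
(with the convention that the valuation of `0` is `+∞`). -/
def CongrMod (p m : ℕ) (x y : ℚ) : Prop :=
  x = y ∨ (m : ℤ) ≤ padicValRat p (x - y)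

/-- The Bernoulli polynomial `B_n` evaluated at a rational `x`. -/
noncomputable def bpoly (n : ℕ) (x : ℚ) : ℚ := (Polynomial.bernoulli n).eval x

/-- The Euler polynomial `E_n` evaluated at a rational `x`, via
`E_n(x) = (2/(n+1))·(B_{n+1}(x) − 2^{n+1}·B_{n+1}(x/2))`. -/
noncomputable def epoly (n : ℕ) (x : ℚ) : ℚ :=
  (2 / (n + 1 : ℚ)) * (bpoly (n + 1) x - 2 ^ (n + 1) * bpoly (n + 1) (x / 2))

/-- The Euler number `E_n = 2^n · E_n(1/2)`. -/
noncomputable def eulerNum (n : ℕ) : ℚ := 2 ^ n * epoly n (1 / 2)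

/-- The rational numbers that are integral at `p`. -/
def pIntegral (p : ℕ) [Fact p.Prime] : Subring ℚ where
  carrier := {x | padicNorm p x ≤ 1}
  mul_mem' {x y} hx hy := by
    simpa using mul_le_one₀ hx (padicNorm.nonneg y) hy
  one_mem' := by simp
  add_mem' hx hy := padicNorm.nonarchimedean.trans (max_le hx hy)
  zero_mem' := by simp
  neg_mem' {x} hx := by simpa using hx

lemma mem_pIntegral {p : ℕ} [Fact p.Prime] {x : ℚ} :
    x ∈ pIntegral p ↔ padicNorm p x ≤ 1 := Iff.rfl

/-- The pairs of `p`-integral rationals that are congruent modulo `p`. -/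
def congrPairs (p : ℕ) [Fact p.Prime] : Subring (ℚ × ℚ) where
  carrier := {x | x.1 ∈ pIntegral p ∧ x.2 ∈ pIntegral p ∧ (x.1 - x.2) / p ∈ pIntegral p}
  mul_mem' {x y} hx hy := by
    refine ⟨mul_mem hx.1 hy.1, mul_mem hx.2.1 hy.2.1, ?_⟩
    have := add_mem (mul_mem hx.1 hy.2.2) (mul_mem hx.2.2 hy.2.1)
    convert this using 1
    simp only [Prod.fst_mul, Prod.snd_mul]
    ring
  one_mem' := ⟨one_mem _, one_mem _, by simp [zero_mem]⟩
  add_mem' {x y} hx hy := by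
    refine ⟨add_mem hx.1 hy.1, add_mem hx.2.1 hy.2.1, ?_⟩
    convert add_mem hx.2.2 hy.2.2 using 1
    simp only [Prod.fst_add, Prod.snd_add]
    ring
  zero_mem' := ⟨zero_mem _, zero_mem _, by simp [zero_mem]⟩
  neg_mem' {x} hx := by
    refine ⟨neg_mem hx.1, neg_mem hx.2.1, ?_⟩
    convert neg_mem hx.2.2 using 1
    simp only [Prod.fst_neg, Prod.snd_neg]
    ring

section Congruence

variable {p : ℕ} [Fact p.Prime]

lemma diag_mem_congrPairs {x : ℚ} (hx : x ∈ pIntegral p) : (x, x) ∈ congrPairs p :=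
  ⟨hx, hx, by simp [zero_mem]⟩

lemma congrPairs_symm {x y : ℚ} (h : (x, y) ∈ congrPairs p) : (y, x) ∈ congrPairs p := by
  refine ⟨h.2.1, h.1, ?_⟩
  convert neg_mem h.2.2 using 1
  ring

lemma congrPairs_trans {x y z : ℚ} (h : (x, y) ∈ congrPairs p) (h' : (y, z) ∈ congrPairs p) :
    (x, z) ∈ congrPairs p := by
  refine ⟨h.1, h'.2.1, ?_⟩
  convert add_mem h.2.2 h'.2.2 using 1
  ring

lemma congrMod_of_mem_congrPairs {x y : ℚ} (h : (x, y) ∈ congrPairs p) : CongrMod p 1 x y := by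
  have hp := (Fact.out : p.Prime)
  by_cases hxy : x = y
  · exact Or.inl hxy
  right
  have h1 := mem_pIntegral.1 h.2.2
  have hp0 : (0 : ℚ) < p := by exact_mod_cast hp.pos
  rw [padicNorm.div, padicNorm.padicNorm_p_of_prime, div_inv_eq_mul,
    padicNorm.eq_zpow_of_nonzero (sub_ne_zero.2 hxy), ← zpow_add_one₀ hp0.ne'] at h1
  have h2 := (zpow_le_one_iff_right₀ (by exact_mod_cast hp.one_lt)).1 h1
  push_cast
  linarith

lemma inv_natCast_mem_pIntegral {m : ℕ} (hm : ¬ p ∣ m) : (m : ℚ)⁻¹ ∈ pIntegral p := by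
  have h := (padicNorm.nat_eq_one_iff (p := p) m).2 hm
  rw [mem_pIntegral, ← one_div, padicNorm.div, h]
  simp

lemma inv_natCast_mem_pIntegral_of_lt {m : ℕ} (h0 : 0 < m) (hm : m < p) :
    (m : ℚ)⁻¹ ∈ pIntegral p :=
  inv_natCast_mem_pIntegral (Nat.not_dvd_of_pos_of_lt h0 hm)

lemma natCast_self_mem_congrPairs : ((p : ℚ), (0 : ℚ)) ∈ congrPairs p := by
  have hp := (Fact.out : p.Prime)
  refine ⟨natCast_mem _ p, zero_mem _, ?_⟩
  have hp0 : (p : ℚ) ≠ 0 := by exact_mod_cast hp.ne_zero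
  simp [hp0, one_mem]

lemma intCast_mem_congrPairs {x y : ℤ} (h : (x : ZMod p) = y) :
    ((x : ℚ), (y : ℚ)) ∈ congrPairs p := by
  have hp := (Fact.out : p.Prime)
  have hp0 : (p : ℚ) ≠ 0 := by exact_mod_cast hp.ne_zero
  refine ⟨intCast_mem _ x, intCast_mem _ y, ?_⟩
  obtain ⟨c, hc⟩ := (ZMod.intCast_eq_intCast_iff_dvd_sub y x p).1 h.symm
  have hc' : (x : ℚ) - y = p * c := by exact_mod_cast hc
  simp only [hc', mul_div_cancel_left₀ _ hp0]
  exact intCast_mem _ c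

lemma exists_natCast_mem_congrPairs {a : ℚ} (ha : ¬ p ∣ a.den) :
    ∃ m < p, (a, (m : ℚ) + 1) ∈ congrPairs p := by
  have hden : (a.den : ZMod p) ≠ 0 := by
    rwa [Ne, ZMod.natCast_eq_zero_iff]
  set z : ZMod p := a.num / a.den - 1 with hz
  refine ⟨z.val, z.val_lt, ?_⟩
  have h1 : ((a.num : ℤ) : ZMod p) = (((z.val : ℤ) + 1) * a.den : ℤ) := by
    push_cast
    rw [ZMod.natCast_zmod_val, hz]
    field_simp
    ring
  have h2 := mul_mem (intCast_mem_congrPairs h1)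
    (diag_mem_congrPairs (inv_natCast_mem_pIntegral ha))
  have hd : (a.den : ℚ) ≠ 0 := by exact_mod_cast a.den_nz
  convert h2 using 1
  ext
  · simp only [Prod.fst_mul]
    rw [← div_eq_mul_inv, Rat.num_div_den]
  · simp only [Prod.snd_mul]
    push_cast
    field_simp

lemma eval_mem_congrPairs {Q : Polynomial ℚ} (hQ : ∀ i, Q.coeff i ∈ pIntegral p) {x y : ℚ}
    (h : (x, y) ∈ congrPairs p) : (Q.eval x, Q.eval y) ∈ congrPairs p := by
  have := sum_mem (S := congrPairs p) (t := range (Q.natDegree + 1))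
    (f := fun i => (Q.coeff i, Q.coeff i) * (x, y) ^ i)
    fun i _ => mul_mem (diag_mem_congrPairs (hQ i)) (pow_mem h i)
  convert this using 1
  ext
  · simp [Prod.fst_sum, Polynomial.eval_eq_sum_range]
  · simp [Prod.snd_sum, Polynomial.eval_eq_sum_range]

lemma bernoulli'_mem_pIntegral (n : ℕ) (hn : n + 1 < p) : bernoulli' n ∈ pIntegral p := by
  induction n using Nat.strong_induction_on with
  | _ n ih =>
    rw [bernoulli'_def]
    refine sub_mem (one_mem _) (sum_mem fun k hk => ?_)
    have hk := mem_range.1 hk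
    refine mul_mem ?_ (ih k hk (by omega))
    rw [div_eq_mul_inv]
    refine mul_mem (natCast_mem _ _) ?_
    have := inv_natCast_mem_pIntegral_of_lt (p := p) (m := n - k + 1) (by omega) (by omega)
    rwa [Nat.cast_add, Nat.cast_sub hk.le, Nat.cast_one] at this

lemma coeff_bernoulli_mem_pIntegral {n : ℕ} (hn : n + 1 < p) (i : ℕ) :
    (Polynomial.bernoulli n).coeff i ∈ pIntegral p := by
  rw [Polynomial.coeff_bernoulli]
  split_ifs with h
  · rw [_root_.bernoulli]
    exact mul_mem (mul_mem (pow_mem (neg_mem (one_mem _)) _)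
      (bernoulli'_mem_pIntegral _ (by omega))) (natCast_mem _ _)
  · exact zero_mem _

lemma bpoly_mem_congrPairs {n : ℕ} (hn : n + 1 < p) {x y : ℚ} (h : (x, y) ∈ congrPairs p) :
    (bpoly n x, bpoly n y) ∈ congrPairs p :=
  eval_mem_congrPairs (coeff_bernoulli_mem_pIntegral hn) h

lemma odd_prime_sub_two (hp3 : 3 < p) : Odd (p - 2) := by
  have := (Fact.out : p.Prime).odd_of_ne_two (by omega)
  obtain ⟨r, hr⟩ := this
  exact ⟨r - 1, by omega⟩

lemma pow_sub_three_mem_congrPairs (hp3 : 3 < p) {m : ℕ} (h0 : 0 < m) (hm : m < p) :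
    (((p - 2 : ℕ) : ℚ) * (m : ℚ) ^ (p - 3), -2 / (m : ℚ) ^ 2) ∈ congrPairs p := by
  have hm0 : (m : ZMod p) ≠ 0 := by
    rw [Ne, ZMod.natCast_eq_zero_iff]
    exact Nat.not_dvd_of_pos_of_lt h0 hm
  have h1 : (((p - 2 : ℕ) * m ^ (p - 1) : ℤ) : ZMod p) = ((-2 : ℤ) : ZMod p) := by
    push_cast
    rw [ZMod.pow_card_sub_one_eq_one hm0, Nat.cast_sub (by omega)]
    simp
  have h2 := mul_mem (intCast_mem_congrPairs h1)
    (pow_mem (diag_mem_congrPairs (inv_natCast_mem_pIntegral_of_lt h0 hm)) 2)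
  have hmQ : (m : ℚ) ≠ 0 := by exact_mod_cast h0.ne'
  convert h2 using 1
  ext
  · simp only [Prod.fst_mul, Prod.pow_fst]
    rw [show p - 1 = p - 3 + 2 by omega, pow_add]
    push_cast
    field_simp
  · simp only [Prod.snd_mul, Prod.pow_snd]
    push_cast
    field_simp

lemma bpoly_congr_harm2 (hp3 : 3 < p) {m : ℕ} (hm : m < p) :
    (bpoly (p - 2) (m + 1), -2 * harm2 m) ∈ congrPairs p := by
  induction m with
  | zero =>
    have : bpoly (p - 2) ((0 : ℕ) + 1) = 0 := by
      simp [bpoly, bernoulli'_eq_zero_of_odd (odd_prime_sub_two hp3) (by omega)]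
    rw [this]
    simp only [harm2, range_zero, sum_empty, mul_zero]
    exact zero_mem _
  | succ m ih =>
    have h := add_mem (ih (by omega)) (pow_sub_three_mem_congrPairs hp3 m.succ_pos hm)
    convert h using 1
    ext
    · simp only [bpoly, Prod.fst_add]
      rw [add_comm _ (1 : ℚ), Polynomial.bernoulli_eval_one_add, show p - 2 - 1 = p - 3 by omega]
      push_cast
      rfl
    · simp only [harm2, Prod.snd_add, sum_range_succ]
      push_cast
      ring

lemma harm2_mem_pIntegral {k : ℕ} (hk : k < p) : harm2 k ∈ pIntegral p := by
  refine sum_mem fun j hj => ?_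
  have hj := mem_range.1 hj
  have := pow_mem (inv_natCast_mem_pIntegral_of_lt (p := p) j.succ_pos (by omega)) 2
  simpa using this

lemma harm2_div_mem_pIntegral (hp3 : 3 < p) {k : ℕ} (hk : k < p) :
    harm2 k / (2 * k + 1) ∈ pIntegral p := by
  by_cases hd : p ∣ 2 * k + 1
  · obtain ⟨c, hc⟩ := hd
    have hc1 : c = 1 := by
      have : c < 2 := by
        by_contra! h
        nlinarith
      interval_cases c <;> omega
    have hpk : p = 2 * k + 1 := by rw [hc, hc1, mul_one]
    have hpkQ : (p : ℚ) = 2 * k + 1 := by exact_mod_cast hpk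
    have hrefl : ((-k : ℚ), (k : ℚ) + 1) ∈ congrPairs p := by
      have := sub_mem (diag_mem_congrPairs (natCast_mem (pIntegral p) (k + 1)))
        (natCast_self_mem_congrPairs (p := p))
      convert this using 1
      ext
      · simp only [Prod.fst_sub, hpkQ]
        push_cast
        ring
      · simp
    have hB := bpoly_mem_congrPairs (n := p - 2) (by omega) hrefl
    have hodd : bpoly (p - 2) (-k) = -bpoly (p - 2) (k + 1) := by
      rw [bpoly, show (-k : ℚ) = 1 - (k + 1) by ring, Polynomial.bernoulli_eval_one_sub,
        (odd_prime_sub_two hp3).neg_one_pow, bpoly]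
      ring
    have hBH := bpoly_congr_harm2 hp3 hk
    have h2 : (2 : ℚ)⁻¹ ∈ pIntegral p := by
      exact_mod_cast inv_natCast_mem_pIntegral_of_lt (p := p) two_pos (by omega)
    have := mul_mem (pow_mem h2 2) (add_mem hB.2.2 (mul_mem (natCast_mem _ 2) hBH.2.2))
    convert this using 1
    simp only [hodd, hpkQ]
    push_cast
    ring
  · have := mul_mem (harm2_mem_pIntegral hk) (inv_natCast_mem_pIntegral hd)
    rw [div_eq_mul_inv]
    exact_mod_cast this

lemma gchoose_mem_congrPairs {x y : ℚ} (h : (x, y) ∈ congrPairs p) {k : ℕ} (hk : k < p) :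
    (gchoose x k, gchoose y k) ∈ congrPairs p := by
  have hp := (Fact.out : p.Prime)
  have hfac : ¬ p ∣ k.factorial := by
    rw [hp.dvd_factorial]
    omega
  have := mul_mem
    (prod_mem (S := congrPairs p) (t := range k) (f := fun j : ℕ => (x, y) - ((j : ℚ), (j : ℚ)))
      fun j _ => sub_mem h (diag_mem_congrPairs (natCast_mem _ j)))
    (diag_mem_congrPairs (inv_natCast_mem_pIntegral hfac))
  convert this using 1
  ext
  · simp [gchoose, Prod.fst_prod, div_eq_mul_inv]
  · simp [gchoose, Prod.snd_prod, div_eq_mul_inv]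

/-- The left-hand side of the congruence, with the sum taken over `k < N`. -/
noncomputable def weightedSum (N : ℕ) (a : ℚ) : ℚ :=
  (2 * a - 1) *
    ∑ k ∈ range N, gchoose (-a) k * gchoose (a - 1) k * harm2 k / (2 * k + 1)

lemma weightedSum_mem_congrPairs (hp3 : 3 < p) {x y : ℚ} (h : (x, y) ∈ congrPairs p) :
    (weightedSum p x, weightedSum p y) ∈ congrPairs p := by
  have h1 := diag_mem_congrPairs (one_mem (pIntegral p))
  have := mul_mem (sub_mem (add_mem h h) h1)
    (sum_mem (S := congrPairs p) (t := range p)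
      (f := fun k : ℕ => (gchoose (-x) k, gchoose (-y) k) * (gchoose (x - 1) k, gchoose (y - 1) k)
        * (harm2 k / (2 * k + 1), harm2 k / (2 * k + 1)))
      fun k hk => by
        have hk := mem_range.1 hk
        exact mul_mem (mul_mem (gchoose_mem_congrPairs (neg_mem h) hk)
          (gchoose_mem_congrPairs (sub_mem h h1) hk))
          (diag_mem_congrPairs (harm2_div_mem_pIntegral hp3 hk)))
  convert this using 1
  ext
  · simp [weightedSum, Prod.fst_sum, mul_div_assoc, two_mul]
  · simp [weightedSum, Prod.snd_sum, mul_div_assoc, two_mul]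

end Congruence

lemma gchoose_succ (a : ℚ) (k : ℕ) : gchoose a (k + 1) = gchoose a k * (a - k) / (k + 1) := by
  have : (k.factorial : ℚ) ≠ 0 := by exact_mod_cast k.factorial_ne_zero
  rw [gchoose, gchoose, prod_range_succ, Nat.factorial_succ]
  push_cast
  field_simp

lemma gchoose_natCast_eq_zero {m k : ℕ} (h : m < k) : gchoose m k = 0 := by
  rw [gchoose, prod_eq_zero (mem_range.2 h) (sub_self _), zero_div]

lemma mul_gchoose_sub_one (a : ℚ) (k : ℕ) : a * gchoose (a - 1) k = (a - k) * gchoose a k := by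
  induction k with
  | zero => simp [gchoose]
  | succ k ih =>
    rw [gchoose_succ, gchoose_succ]
    push_cast
    linear_combination (a - 1 - k) / (k + 1) * ih

lemma add_one_mul_gchoose (a : ℚ) (k : ℕ) :
    a * gchoose (-(a + 1)) k = (a + k) * gchoose (-a) k := by
  have := mul_gchoose_sub_one (-a) k
  rw [show -(a + 1) = -a - 1 by ring]
  linear_combination -this

lemma weight_add_one_sub {a : ℚ} (ha : a ≠ 0) (k : ℕ) :
    (2 * (a + 1) - 1) * (gchoose (-(a + 1)) k * gchoose (a + 1 - 1) k) -
      (2 * a - 1) * (gchoose (-a) k * gchoose (a - 1) k) =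
      2 * (2 * k + 1) * (gchoose (-a) k * gchoose a k) := by
  have h1 := mul_gchoose_sub_one a k
  have h2 := add_one_mul_gchoose a k
  rw [add_sub_cancel_right]
  apply mul_left_cancel₀ ha
  linear_combination (2 * a + 1) * gchoose a k * h2 - (2 * a - 1) * gchoose (-a) k * h1

lemma sq_mul_sum_gchoose (a : ℚ) (N : ℕ) :
    a ^ 2 * ∑ k ∈ range N, gchoose (-a) k * gchoose a k =
      -(N ^ 2 * (gchoose (-a) N * gchoose a N)) := by
  induction N with
  | zero => simp
  | succ N ih =>
    rw [sum_range_succ, mul_add, ih, gchoose_succ, gchoose_succ]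
    push_cast
    field_simp
    ring

lemma sq_mul_sum_gchoose_harm2 (a : ℚ) (N : ℕ) :
    a ^ 2 * ∑ k ∈ range N, gchoose (-a) k * gchoose a k * harm2 k =
      ∑ k ∈ range N, gchoose (-a) k * gchoose a k - 1
        + gchoose (-a) N * gchoose a N * (1 - N ^ 2 * harm2 N) := by
  induction N with
  | zero => simp [gchoose, harm2]
  | succ N ih =>
    have hh : harm2 (N + 1) = harm2 N + 1 / ((N : ℚ) + 1) ^ 2 := by
      simp [harm2, sum_range_succ]
    rw [sum_range_succ, sum_range_succ, mul_add, ih, gchoose_succ, gchoose_succ, hh]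
    push_cast
    field_simp
    ring

lemma weightedSum_add_one_sub {a : ℚ} (ha : a ≠ 0) (N : ℕ) :
    weightedSum N (a + 1) - weightedSum N a =
      2 * ∑ k ∈ range N, gchoose (-a) k * gchoose a k * harm2 k := by
  rw [weightedSum, weightedSum, mul_sum, mul_sum, mul_sum, ← sum_sub_distrib]
  refine sum_congr rfl fun k _ => ?_
  have h := weight_add_one_sub ha k
  have hk : (2 * k + 1 : ℚ) ≠ 0 := by positivity
  field_simp
  linear_combination harm2 k * h

lemma weightedSum_natCast (N m : ℕ) (hm : m < N) : weightedSum N (m + 1) = -2 * harm2 m := by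
  induction m with
  | zero =>
    rw [weightedSum, sum_eq_zero]
    · simp [harm2]
    · intro k _
      rcases k.eq_zero_or_pos with rfl | hk
      · simp [harm2]
      · have := gchoose_natCast_eq_zero hk
        simp_all
  | succ m ih =>
    have ha : ((m + 1 : ℕ) : ℚ) ≠ 0 := by positivity
    have h1 := weightedSum_add_one_sub ha N
    have h2 := sq_mul_sum_gchoose_harm2 ((m + 1 : ℕ) : ℚ) N
    have h3 := sq_mul_sum_gchoose ((m + 1 : ℕ) : ℚ) N
    rw [gchoose_natCast_eq_zero hm, mul_zero, mul_zero, neg_zero] at h3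
    rw [gchoose_natCast_eq_zero hm, (mul_eq_zero.1 h3).resolve_left (pow_ne_zero 2 ha)] at h2
    have h4 : weightedSum N ((m + 1 : ℕ) : ℚ) = -2 * harm2 m := by
      rw [← ih (by omega)]
      push_cast
      rfl
    have hh : harm2 (m + 1) = harm2 m + 1 / ((m + 1 : ℕ) : ℚ) ^ 2 := by
      simp [harm2, sum_range_succ]
    rw [hh]
    field_simp
    linear_combination ((m + 1 : ℕ) : ℚ) ^ 2 * (h1 + h4) + 2 * h2

theorem stmt_12 (p : ℕ) (hp : p.Prime) (hp3 : 3 < p) (a : ℚ) (ha : ¬ (p ∣ a.den)) :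
    CongrMod p 1
      ((2 * a - 1) *
        ∑ k ∈ Finset.range p, gchoose (-a) k * gchoose (a - 1) k * harm2 k / (2 * k + 1))
      (bpoly (p - 2) a) := by
  have := Fact.mk hp
  obtain ⟨m, hm, h⟩ := exists_natCast_mem_congrPairs ha
  have hsum := weightedSum_mem_congrPairs hp3 h
  rw [weightedSum_natCast p m hm] at hsum
  exact congrMod_of_mem_congrPairs <| congrPairs_trans hsum <| congrPairs_symm <|
    congrPairs_trans (bpoly_mem_congrPairs (by omega) h) (bpoly_congr_harm2 hp3 hm)
end

section
/- Let p > 3 be a prime. Then Σ_{k=0}^{p-1} binom(4k,2k)·binom(2k,k)/64^k · H_k^{(2)} ≡ -E_{p²-p-2}(1/4) (mod p²), and in particular this sum is ≡ -E_{p-3}(1/4) (mod p). -/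
open Finset

open Polynomial in
/-- A rational polynomial invariant under translation by `1` is constant. -/
lemma Polynomial.eq_C_of_eval_add_one {Q : ℚ[X]} (h : ∀ x : ℚ, Q.eval (x + 1) = Q.eval x) :
    Q = C (Q.eval 0) := by
  have hn : ∀ n : ℕ, Q.eval (n : ℚ) = Q.eval 0 := by
    intro n
    induction n with
    | zero => simp
    | succ k ih => rw [Nat.cast_succ, h, ih]
  refine Polynomial.eq_of_infinite_eval_eq _ _ ?_
  refine (Set.infinite_range_of_injective (Nat.cast_injective (R := ℚ))).mono ?_
  rintro _ ⟨n, rfl⟩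
  simp [hn]

open Polynomial in
/-- The duplication formula for Bernoulli polynomials. -/
lemma bernoulli_duplication (n : ℕ) (x : ℚ) :
    2 ^ n * ((Polynomial.bernoulli (n + 1)).eval (x / 2) +
      (Polynomial.bernoulli (n + 1)).eval ((x + 1) / 2)) =
    (Polynomial.bernoulli (n + 1)).eval x := by
  let M : ℕ → ℚ[X] := fun m => C (2 ^ m) * ((Polynomial.bernoulli (m + 1)).comp (C (1 / 2) * X) +
      (Polynomial.bernoulli (m + 1)).comp (C (1 / 2) * X + C (1 / 2))) - Polynomial.bernoulli (m + 1)
  have hM : ∀ m (y : ℚ), (M m).eval y = 2 ^ m * ((Polynomial.bernoulli (m + 1)).eval (y / 2) +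
      (Polynomial.bernoulli (m + 1)).eval ((y + 1) / 2)) -
      (Polynomial.bernoulli (m + 1)).eval y := by
    intro m y
    simp only [M, eval_sub, eval_mul, eval_add, eval_comp, eval_C, eval_X]
    ring_nf
  have hper : ∀ m (y : ℚ), (M m).eval (y + 1) = (M m).eval y := by
    intro m y
    rw [hM, hM, show (y + 1 + 1) / 2 = 1 + y / 2 by ring, bernoulli_eval_one_add,
      add_comm y 1, bernoulli_eval_one_add]
    simp only [Nat.add_sub_cancel, div_pow]
    field_simp
    ring
  have hder : derivative (M (n + 1)) = C ((n : ℚ) + 2) * M n := by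
    simp only [M, derivative_sub, derivative_mul, derivative_add, derivative_comp, derivative_C,
      derivative_X, derivative_bernoulli_add_one, mul_comp, add_comp, natCast_comp, one_comp]
    have h2 : (C ((2 : ℚ) ^ (n + 1)) : ℚ[X]) = C (2 ^ n) * C 2 := by rw [pow_succ, C_mul]
    have h1 : (C (2 : ℚ) : ℚ[X]) * C (1 / 2) = 1 := by rw [← C_mul]; norm_num
    have h3 : (C ((n : ℚ) + 2) : ℚ[X]) = (n : ℚ[X]) + 2 := by
      rw [C_add, C_eq_natCast]; rfl
    rw [h2, h3]
    push_cast
    linear_combination (C (2 ^ n) * ((n : ℚ[X]) + 2) *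
      ((Polynomial.bernoulli (n + 1)).comp (C (1 / 2) * X) +
      (Polynomial.bernoulli (n + 1)).comp (C (1 / 2) * X + C (1 / 2)))) * h1
  rw [Polynomial.eq_C_of_eval_add_one (hper (n + 1)), derivative_C] at hder
  have h0 := congrArg (Polynomial.eval x) hder
  simp only [eval_zero, eval_mul, eval_C] at h0
  have hn : (n : ℚ) + 2 ≠ 0 := by positivity
  have := (mul_eq_zero.mp h0.symm).resolve_left hn
  rw [hM] at this
  linarith

lemma epoly_add_epoly_one_add (n : ℕ) (x : ℚ) : epoly n x + epoly n (x + 1) = 2 * x ^ n := by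
  have h := bernoulli_duplication n x
  have h1 := Polynomial.bernoulli_eval_one_add (n + 1) x
  rw [add_comm 1 x, Nat.add_sub_cancel] at h1
  push_cast at h1
  have hn : (n : ℚ) + 1 ≠ 0 := by positivity
  simp only [epoly, bpoly]
  field_simp
  rw [h1, pow_succ]
  linear_combination (-2 : ℚ) * h

/-- `binom(x,k) * binom(-1-x,k)` as a product. -/
def binomProd (x : ℚ) (k : ℕ) : ℚ :=
  ∏ j ∈ Finset.range k, ((x - j) * (-1 - x - j) / ((j : ℚ) + 1) ^ 2)

/-- `∏_{j=1}^k (1 - x²/j²)`. -/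
def sqProd (x : ℚ) (k : ℕ) : ℚ := ∏ j ∈ Finset.range k, (1 - x ^ 2 / ((j : ℚ) + 1) ^ 2)

/-- The truncated sum `∑_{k<p} binom(x,k) binom(-1-x,k) H_k^{(2)}`. -/
def harmSum (p : ℕ) (x : ℚ) : ℚ := ∑ k ∈ Finset.range p, binomProd x k * harm2 k

lemma binomProd_neg_quarter (k : ℕ) :
    (Nat.choose (4 * k) (2 * k) : ℚ) * (Nat.choose (2 * k) k) / 64 ^ k =
      binomProd (-1 / 4) k := by
  rw [show 4 * k = 2 * (2 * k) by ring, ← Nat.centralBinom_eq_two_mul_choose,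
    ← Nat.centralBinom_eq_two_mul_choose]
  induction k with
  | zero => simp [binomProd]
  | succ k ih =>
    have e1 := Nat.succ_mul_centralBinom_succ k
    have e2 := Nat.succ_mul_centralBinom_succ (2 * k)
    have e3 := Nat.succ_mul_centralBinom_succ (2 * k + 1)
    rw [binomProd, Finset.prod_range_succ, ← binomProd, ← ih,
      show 2 * (k + 1) = 2 * k + 1 + 1 by ring]
    qify at e1 e2 e3
    have e1' : (Nat.centralBinom (k + 1) : ℚ) =
        2 * (2 * k + 1) * Nat.centralBinom k / (k + 1) := by
      field_simp; linear_combination e1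
    have e2' : (Nat.centralBinom (2 * k + 1) : ℚ) =
        2 * (2 * (2 * k) + 1) * Nat.centralBinom (2 * k) / (2 * k + 1) := by
      field_simp; linear_combination e2
    have e3' : (Nat.centralBinom (2 * k + 1 + 1) : ℚ) =
        2 * (2 * (2 * k + 1) + 1) * Nat.centralBinom (2 * k + 1) / (2 * k + 1 + 1) := by
      field_simp; linear_combination e3
    rw [e3', e2', e1']
    field_simp
    ring

lemma binomProd_succ (x : ℚ) (k : ℕ) :
    binomProd x (k + 1) = sqProd x k * (-x * (x + k + 1) / ((k : ℚ) + 1) ^ 2) := by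
  induction k with
  | zero => simp [binomProd, sqProd]; ring
  | succ k ih =>
    rw [binomProd, Finset.prod_range_succ, ← binomProd, ih, sqProd, sqProd,
      Finset.prod_range_succ]
    push_cast
    field_simp
    ring

lemma binomProd_sub_one_succ (x : ℚ) (k : ℕ) :
    binomProd (x - 1) (k + 1) = sqProd x k * (-x * (x - k - 1) / ((k : ℚ) + 1) ^ 2) := by
  induction k with
  | zero => simp [binomProd, sqProd]; ring
  | succ k ih =>
    rw [binomProd, Finset.prod_range_succ, ← binomProd, ih, sqProd, sqProd,
      Finset.prod_range_succ]
    push_cast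
    field_simp
    ring

lemma harmSum_add_harmSum_sub_one (x : ℚ) (n : ℕ) :
    x ^ 2 * (harmSum (n + 1) x + harmSum (n + 1) (x - 1)) =
      2 * (x ^ 2 * sqProd x n * harm2 n + sqProd x n - 1) := by
  induction n with
  | zero => simp [harmSum, sqProd, harm2]
  | succ n ih =>
    rw [harmSum, harmSum, Finset.sum_range_succ, Finset.sum_range_succ _ (n + 1), ← harmSum,
      ← harmSum, binomProd_succ, binomProd_sub_one_succ]
    have hP : sqProd x (n + 1) = sqProd x n * (1 - x ^ 2 / ((n : ℚ) + 1) ^ 2) :=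
      Finset.prod_range_succ _ _
    have hH : harm2 (n + 1) = harm2 n + 1 / ((n : ℚ) + 1) ^ 2 := Finset.sum_range_succ _ _
    rw [hP, hH]
    have hn : (n : ℚ) + 1 ≠ 0 := by positivity
    have e : x ^ 2 * (harmSum (n + 1) x + sqProd x n * (-x * (x + n + 1) / ((n : ℚ) + 1) ^ 2) *
        (harm2 n + 1 / ((n : ℚ) + 1) ^ 2) + (harmSum (n + 1) (x - 1) +
        sqProd x n * (-x * (x - n - 1) / ((n : ℚ) + 1) ^ 2) *
        (harm2 n + 1 / ((n : ℚ) + 1) ^ 2))) =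
        x ^ 2 * (harmSum (n + 1) x + harmSum (n + 1) (x - 1)) +
        x ^ 2 * (sqProd x n * (-x * (x + n + 1) / ((n : ℚ) + 1) ^ 2) *
        (harm2 n + 1 / ((n : ℚ) + 1) ^ 2) +
        sqProd x n * (-x * (x - n - 1) / ((n : ℚ) + 1) ^ 2) *
        (harm2 n + 1 / ((n : ℚ) + 1) ^ 2)) := by ring
    rw [e, ih]
    field_simp
    ring

section Padic

variable {p : ℕ} [hp : Fact p.Prime]

lemma inv_mem_subring {j : ℕ} (hj : j + 1 < p) :
    ((j : ℚ_[p]) + 1)⁻¹ ∈ PadicInt.subring p := by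
  have h : ‖((j + 1 : ℕ) : ℚ_[p])‖ = 1 := by
    rw [Padic.norm_natCast_eq_one_iff]
    exact Nat.coprime_of_lt_prime (by omega) hj hp.out
  rw [PadicInt.mem_subring_iff, norm_inv]
  push_cast at h
  simp [h]

lemma harm2_mem_subring {k : ℕ} (hk : k < p) : ((harm2 k : ℚ) : ℚ_[p]) ∈ PadicInt.subring p := by
  simp only [harm2, Rat.cast_sum]
  refine sum_mem fun j hj => ?_
  have hj' := Finset.mem_range.mp hj
  have := pow_mem (inv_mem_subring (p := p) (j := j) (by omega)) 2
  push_cast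
  rwa [one_div, ← inv_pow]

lemma exists_sqProd_eq {x : ℚ} (hx : ((x : ℚ) : ℚ_[p]) ∈ PadicInt.subring p) {k : ℕ} (hk : k < p) :
    ∃ c ∈ PadicInt.subring p, ((sqProd x k : ℚ) : ℚ_[p]) =
      1 - (x : ℚ_[p]) ^ 2 * (harm2 k : ℚ) + (x : ℚ_[p]) ^ 4 * c := by
  induction k with
  | zero => exact ⟨0, zero_mem _, by simp [sqProd, harm2]⟩
  | succ k ih =>
    obtain ⟨c, hc, h⟩ := ih (by omega)
    have hP : sqProd x (k + 1) = sqProd x k * (1 - x ^ 2 / ((k : ℚ) + 1) ^ 2) :=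
      Finset.prod_range_succ _ _
    have hH : harm2 (k + 1) = harm2 k + 1 / ((k : ℚ) + 1) ^ 2 := Finset.sum_range_succ _ _
    have hi := pow_mem (inv_mem_subring hk) 2
    refine ⟨c * (1 - (x : ℚ_[p]) ^ 2 * ((k : ℚ_[p]) + 1)⁻¹ ^ 2) +
      (harm2 k : ℚ) * ((k : ℚ_[p]) + 1)⁻¹ ^ 2, ?_, ?_⟩
    · exact add_mem (mul_mem hc (sub_mem (one_mem _) (mul_mem (pow_mem hx 2) hi)))
        (mul_mem (harm2_mem_subring (by omega)) hi)
    · rw [hP, hH]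
      push_cast
      rw [h]
      simp only [div_eq_mul_inv, inv_pow, one_mul]
      ring

lemma norm_prod_sub_le {y : ℚ_[p]} (hy : ‖y‖ = 1) :
    ‖∏ j ∈ Finset.range (p - 1), ((j : ℚ_[p]) + 1 - y)‖ ≤ (p : ℝ)⁻¹ := by
  let z : ℤ_[p] := ⟨y, hy.le⟩
  obtain ⟨n, hn, hz⟩ := PadicInt.exists_mem_range z
  have hz1 : ‖z - n‖ < 1 := by
    rwa [← PadicInt.mem_nonunits, ← IsLocalRing.mem_maximalIdeal]
  have hn0 : n ≠ 0 := by
    rintro rfl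
    have : ‖z‖ = 1 := hy
    simp [this] at hz1
  have hint : ∀ j : ℕ, ‖(j : ℚ_[p]) + 1 - y‖ ≤ 1 := fun j =>
    (sub_mem (add_mem (natCast_mem (PadicInt.subring p) j) (one_mem _)) hy.le :
      (j : ℚ_[p]) + 1 - y ∈ PadicInt.subring p)
  have hsmall : ‖((n - 1 : ℕ) : ℚ_[p]) + 1 - y‖ ≤ (p : ℝ)⁻¹ := by
    have h2 : ‖z - n‖ ≤ (p : ℝ) ^ (-(1 : ℕ) : ℤ) := by
      rw [PadicInt.norm_le_pow_iff_mem_span_pow, pow_one, Ideal.mem_span_singleton]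
      exact (PadicInt.norm_lt_one_iff_dvd _).mp hz1
    have h3 : ((n - 1 : ℕ) : ℚ_[p]) + 1 - y = -((z - n : ℤ_[p]) : ℚ_[p]) := by
      rw [Nat.cast_sub (by omega)]
      push_cast
      simp [z]
    rw [h3, norm_neg]
    simpa [PadicInt.norm_def] using h2
  rw [norm_prod, ← Finset.mul_prod_erase _ _ (Finset.mem_range.mpr (by omega : n - 1 < p - 1))]
  calc _ ≤ (p : ℝ)⁻¹ * 1 := by
        refine mul_le_mul hsmall (Finset.prod_le_one (fun _ _ => norm_nonneg _) fun j _ => hint j)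
          (Finset.prod_nonneg fun _ _ => norm_nonneg _) (by positivity)
    _ = _ := mul_one _

lemma norm_sqProd_le {x : ℚ} (hx : ‖(x : ℚ_[p])‖ = 1) :
    ‖((sqProd x (p - 1) : ℚ) : ℚ_[p])‖ ≤ (p : ℝ) ^ (-2 : ℤ) := by
  have e : ((sqProd x (p - 1) : ℚ) : ℚ_[p]) =
      (∏ j ∈ Finset.range (p - 1), ((j : ℚ_[p]) + 1 - x)) *
      (∏ j ∈ Finset.range (p - 1), ((j : ℚ_[p]) + 1 - (-x))) *
      (∏ j ∈ Finset.range (p - 1), ((j : ℚ_[p]) + 1)⁻¹ ^ 2) := by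
    rw [sqProd, Rat.cast_prod, ← Finset.prod_mul_distrib, ← Finset.prod_mul_distrib]
    refine Finset.prod_congr rfl fun j _ => ?_
    have : (j : ℚ_[p]) + 1 ≠ 0 := by exact_mod_cast Nat.succ_ne_zero j
    push_cast
    field_simp
    ring
  have hi : ‖∏ j ∈ Finset.range (p - 1), ((j : ℚ_[p]) + 1)⁻¹ ^ 2‖ ≤ 1 :=
    (prod_mem fun j hj => pow_mem (inv_mem_subring (by
      have := Finset.mem_range.mp hj; omega)) 2 :
      (∏ j ∈ Finset.range (p - 1), ((j : ℚ_[p]) + 1)⁻¹ ^ 2) ∈ PadicInt.subring p)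
  have h1 := norm_prod_sub_le hx
  have h2 := norm_prod_sub_le (y := -(x : ℚ_[p])) (by rwa [norm_neg])
  rw [e, norm_mul, norm_mul]
  calc _ ≤ (p : ℝ)⁻¹ * (p : ℝ)⁻¹ * 1 := by gcongr
    _ = _ := by rw [zpow_neg, mul_one, ← mul_inv]; norm_cast; rw [sq]

lemma norm_pow_totient_sub_one_le {y : ℚ_[p]} (hy : ‖y‖ = 1) (m : ℕ) :
    ‖y ^ (p ^ m).totient - 1‖ ≤ (p : ℝ) ^ (-(m : ℤ)) := by
  let z : ℤ_[p] := ⟨y, hy.le⟩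
  have hu : IsUnit z := PadicInt.isUnit_iff.mpr hy
  have h : ‖z ^ (p ^ m).totient - 1‖ ≤ (p : ℝ) ^ (-(m : ℤ)) := by
    rw [PadicInt.norm_le_pow_iff_mem_span_pow, ← PadicInt.ker_toZModPow, RingHom.mem_ker,
      map_sub, map_pow, map_one, sub_eq_zero]
    obtain ⟨u, hu'⟩ := hu.map (PadicInt.toZModPow m)
    rw [← hu', ← Units.val_pow_eq_pow_val, ZMod.pow_totient, Units.val_one]
  rwa [PadicInt.norm_def, PadicInt.coe_sub, PadicInt.coe_pow, PadicInt.coe_one] at h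

lemma norm_le_inv_of_norm_lt_one {y : ℚ_[p]} (hy : ‖y‖ < 1) : ‖y‖ ≤ (p : ℝ)⁻¹ := by
  have := (Padic.norm_le_pow_iff_norm_lt_pow_add_one y (-1)).mpr (by simpa using hy)
  simpa using this

lemma norm_harmSum_add_le {m n : ℕ} (hm : m ≤ 2) (hn : 2 ≤ n)
    (hmn : n + 2 = (p ^ m).totient) {x : ℚ} (hx0 : x ≠ 0) (hx : ‖(x : ℚ_[p])‖ ≤ 1) :
    ‖((harmSum p x + harmSum p (x - 1) + 2 * (-x) ^ n : ℚ) : ℚ_[p])‖ ≤ (p : ℝ) ^ (-(m : ℤ)) := by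
  have hp1 : p - 1 + 1 = p := Nat.sub_add_cancel hp.out.one_le
  have hp1' : p - 1 < p := by have := hp.out.one_le; omega
  have key := harmSum_add_harmSum_sub_one x (p - 1)
  rw [hp1] at key
  have hmono : (p : ℝ) ^ (-2 : ℤ) ≤ (p : ℝ) ^ (-(m : ℤ)) :=
    zpow_le_zpow_right₀ (by exact_mod_cast hp.out.one_le) (by omega)
  have hy0 : (x : ℚ_[p]) ≠ 0 := by exact_mod_cast hx0
  have h2 : ‖(2 : ℚ_[p])‖ ≤ 1 := (ofNat_mem (PadicInt.subring p) 2 :)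
  have hH := harm2_mem_subring hp1'
  rcases hx.lt_or_eq with hlt | heq
  · have hle := norm_le_inv_of_norm_lt_one hlt
    obtain ⟨c, hc, hP⟩ := exists_sqProd_eq hx hp1'
    obtain ⟨l, rfl⟩ := Nat.exists_eq_add_of_le hn
    set H : ℚ_[p] := ((harm2 (p - 1) : ℚ) : ℚ_[p])
    have e : ((harmSum p x + harmSum p (x - 1) + 2 * (-x) ^ (2 + l) : ℚ) : ℚ_[p]) =
        (x : ℚ_[p]) ^ 2 * (2 * (c + (x : ℚ_[p]) ^ 2 * H * c - H ^ 2 + (-x) ^ l)) := by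
      have key' := congrArg (Rat.cast : ℚ → ℚ_[p]) key
      push_cast at key' ⊢
      rw [hP] at key'
      apply mul_left_cancel₀ (pow_ne_zero 2 hy0)
      rw [mul_add, key', pow_add]
      ring
    have hmem : 2 * (c + (x : ℚ_[p]) ^ 2 * H * c - H ^ 2 + (-x) ^ l) ∈ PadicInt.subring p :=
      mul_mem h2 (add_mem (sub_mem (add_mem hc (mul_mem (mul_mem (pow_mem hx 2) hH) hc))
        (pow_mem hH 2)) (pow_mem (neg_mem hx) l))
    refine le_trans ?_ hmono
    rw [e, norm_mul, norm_pow]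
    calc _ ≤ ((p : ℝ)⁻¹) ^ 2 * 1 := by gcongr; exact hmem
      _ = _ := by rw [mul_one, zpow_neg, inv_pow]; norm_cast
  · set P : ℚ_[p] := ((sqProd x (p - 1) : ℚ) : ℚ_[p]) with hPdef
    set H : ℚ_[p] := ((harm2 (p - 1) : ℚ) : ℚ_[p])
    have hPn : ‖P‖ ≤ (p : ℝ) ^ (-(m : ℤ)) := (norm_sqProd_le heq).trans hmono
    have hE := norm_pow_totient_sub_one_le (y := -(x : ℚ_[p])) (by rwa [norm_neg]) m
    rw [← hmn] at hE
    set E : ℚ_[p] := (-(x : ℚ_[p])) ^ (n + 2) - 1 with hEdef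
    have e : (x : ℚ_[p]) ^ 2 *
        ((harmSum p x + harmSum p (x - 1) + 2 * (-x) ^ n : ℚ) : ℚ_[p]) =
        2 * (((x : ℚ_[p]) ^ 2 * H + 1) * P + E) := by
      have key' := congrArg (Rat.cast : ℚ → ℚ_[p]) key
      push_cast at key' ⊢
      rw [mul_add, key', hEdef]
      ring
    have hn1 : ‖((harmSum p x + harmSum p (x - 1) + 2 * (-x) ^ n : ℚ) : ℚ_[p])‖ =
        ‖2 * (((x : ℚ_[p]) ^ 2 * H + 1) * P + E)‖ := by
      rw [← e, norm_mul, norm_pow, heq]; simp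
    have hmem : ‖(x : ℚ_[p]) ^ 2 * H + 1‖ ≤ 1 :=
      (add_mem (mul_mem (pow_mem hx 2) hH) (one_mem _) :
        (x : ℚ_[p]) ^ 2 * H + 1 ∈ PadicInt.subring p)
    have hb : (0 : ℝ) ≤ (p : ℝ) ^ (-(m : ℤ)) := by positivity
    rw [hn1, norm_mul]
    refine (mul_le_of_le_one_left (norm_nonneg _) h2).trans ?_
    refine (Padic.nonarchimedean _ _).trans (max_le ?_ hE)
    rw [norm_mul]
    exact (mul_le_of_le_one_left (norm_nonneg _) hmem).trans hPn

open Polynomial in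
/-- If a rational polynomial satisfies `D(x) + D(x-1) ≡ 0` at all translates of `a` by positive
integers, then `D(a) ≡ 0`, since odd translations `p ^ N` tend to `0` in `ℚ_[p]`. -/
lemma norm_eval_le_of_add_sub_one (hp2 : p ≠ 2) (D : ℚ[X]) (a : ℚ) {r : ℝ}
    (h : ∀ k : ℕ, ‖((D.eval (a + k + 1) + D.eval (a + k) : ℚ) : ℚ_[p])‖ ≤ r) :
    ‖((D.eval a : ℚ) : ℚ_[p])‖ ≤ r := by
  have hr : 0 ≤ r := (norm_nonneg _).trans (h 0)
  have hk : ∀ k : ℕ, ‖((D.eval a - (-1) ^ k * D.eval (a + k) : ℚ) : ℚ_[p])‖ ≤ r := by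
    intro k
    induction k with
    | zero => simpa using hr
    | succ k ih =>
      have e : ((D.eval a - (-1) ^ (k + 1) * D.eval (a + (k + 1 : ℕ)) : ℚ) : ℚ_[p]) =
          ((D.eval a - (-1) ^ k * D.eval (a + k) : ℚ) : ℚ_[p]) +
          (-1) ^ k * ((D.eval (a + k + 1) + D.eval (a + k) : ℚ) : ℚ_[p]) := by
        push_cast
        rw [← add_assoc]
        ring
      rw [e]
      refine (Padic.nonarchimedean _ _).trans (max_le ih ?_)
      rw [norm_mul, norm_pow, norm_neg, norm_one, one_pow, one_mul]
      exact h k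
  let F : ℚ_[p] → ℚ_[p] := fun y => (D.map (algebraMap ℚ ℚ_[p])).eval y
  have hF : ∀ q : ℚ, F q = (D.eval q : ℚ) := by
    intro q
    have := Polynomial.eval_map_apply (p := D) (f := algebraMap ℚ ℚ_[p]) q
    simpa [F] using this
  have hpow : Filter.Tendsto (fun N : ℕ => (p : ℚ_[p]) ^ N) Filter.atTop (nhds 0) :=
    tendsto_pow_atTop_nhds_zero_of_norm_lt_one Padic.norm_p_lt_one
  have hlim : Filter.Tendsto (fun N : ℕ => ‖F a + F (a + (p : ℚ_[p]) ^ N)‖) Filter.atTop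
      (nhds ‖F a + F (a + 0)‖) := by
    have hc : Continuous F := Polynomial.continuous _
    exact ((hc.tendsto _).comp (hpow.const_add _)).const_add _ |>.norm
  have hle : ‖F a + F (a + 0)‖ ≤ r := by
    refine le_of_tendsto' hlim fun N => ?_
    have := hk (p ^ N)
    rw [Odd.neg_one_pow ((hp.out.odd_of_ne_two hp2).pow)] at this
    have e : F (a + (p : ℚ_[p]) ^ N) = ((D.eval (a + (p ^ N : ℕ)) : ℚ) : ℚ_[p]) := by
      rw [← hF]; push_cast; rfl
    rw [e, hF]
    simpa using this
  have h2 : ‖((2 : ℕ) : ℚ_[p])‖ = 1 := by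
    rw [Padic.norm_natCast_eq_one_iff]
    exact (Nat.coprime_primes hp.out Nat.prime_two).mpr hp2
  rw [add_zero, ← two_mul, norm_mul, hF] at hle
  push_cast at h2
  rwa [h2, one_mul] at hle

open Polynomial in
/-- Both the truncated sum and the Euler polynomial are polynomial functions. -/
lemma exists_polynomial_eval_eq (p n : ℕ) :
    ∃ D : ℚ[X], ∀ x : ℚ, D.eval x = harmSum p x + epoly n (-x) := by
  refine ⟨∑ k ∈ Finset.range p, (∏ j ∈ Finset.range k,
    ((X - C (j : ℚ)) * (C (-1) - X - C (j : ℚ)) * C (1 / ((j : ℚ) + 1) ^ 2))) * C (harm2 k) +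
    C (2 / ((n : ℚ) + 1)) * ((Polynomial.bernoulli (n + 1)).comp (-X) - C (2 ^ (n + 1)) *
      (Polynomial.bernoulli (n + 1)).comp (C (-1 / 2) * X)), fun x => ?_⟩
  have e : (-1 / 2 : ℚ) * x = -x / 2 := by ring
  simp only [harmSum, binomProd, epoly, bpoly, eval_add, eval_finsetSum, eval_mul, eval_prod,
    eval_sub, eval_X, eval_C, eval_comp, eval_neg, e, mul_one_div]

lemma congrMod_of_norm_le {m : ℕ} {x y : ℚ}
    (h : ‖((x - y : ℚ) : ℚ_[p])‖ ≤ (p : ℝ) ^ (-(m : ℤ))) : CongrMod p m x y := by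
  by_cases hxy : x = y
  · exact Or.inl hxy
  · right
    have hne : x - y ≠ 0 := sub_ne_zero.mpr hxy
    rw [Padic.eq_padicNorm, padicNorm.eq_zpow_of_nonzero hne] at h
    push_cast at h
    have := (zpow_le_zpow_iff_right₀ (by exact_mod_cast hp.out.one_lt : (1 : ℝ) < p)).mp h
    omega

lemma congrMod_harmSum_epoly (hp2 : p ≠ 2) {m n : ℕ} (hm : m ≤ 2) (hn : 2 ≤ n)
    (hmn : n + 2 = (p ^ m).totient) :
    CongrMod p m (harmSum p (-1 / 4)) (-(epoly n (1 / 4))) := by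
  obtain ⟨D, hD⟩ := exists_polynomial_eval_eq p n
  apply congrMod_of_norm_le
  have hint : ‖((-1 / 4 : ℚ) : ℚ_[p])‖ ≤ 1 := by
    have h4 : ‖((2 : ℕ) : ℚ_[p])‖ = 1 := by
      rw [Padic.norm_natCast_eq_one_iff]
      exact (Nat.coprime_primes hp.out Nat.prime_two).mpr hp2
    have e : ((-1 / 4 : ℚ) : ℚ_[p]) = -(((2 : ℕ) : ℚ_[p])⁻¹ ^ 2) := by
      push_cast; norm_num
    rw [e, norm_neg, norm_pow, norm_inv, h4]
    simp
  have h := norm_eval_le_of_add_sub_one (p := p) hp2 D (-1 / 4) (r := (p : ℝ) ^ (-(m : ℤ))) ?_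
  · rw [hD] at h
    have e : harmSum p (-1 / 4) + epoly n (-(-1 / 4)) =
        harmSum p (-1 / 4) - -(epoly n (1 / 4)) := by
      norm_num
    rwa [e] at h
  · intro k
    have hx0 : (-1 / 4 + k + 1 : ℚ) ≠ 0 := by
      have : (0 : ℚ) ≤ k := by positivity
      linarith
    have hx : ‖((-1 / 4 + k + 1 : ℚ) : ℚ_[p])‖ ≤ 1 := by
      rw [Rat.cast_add, Rat.cast_add, Rat.cast_natCast, Rat.cast_one]
      exact (add_mem (add_mem hint (natCast_mem _ k)) (one_mem _) :
        ((-1 / 4 : ℚ) : ℚ_[p]) + k + 1 ∈ PadicInt.subring p)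
    have := norm_harmSum_add_le hm hn hmn hx0 hx
    rw [hD, hD]
    have e := epoly_add_epoly_one_add n (-(-1 / 4 + k + 1))
    rw [← e] at this
    convert this using 3
    ring_nf

end Padic

theorem stmt_13 (p : ℕ) (hp : p.Prime) (hp3 : 3 < p) :
    CongrMod p 2
      (∑ k ∈ Finset.range p,
        (Nat.choose (4 * k) (2 * k) : ℚ) * (Nat.choose (2 * k) k) / 64 ^ k * harm2 k)
      (-(epoly (p ^ 2 - p - 2) (1 / 4))) ∧
    CongrMod p 1
      (∑ k ∈ Finset.range p,
        (Nat.choose (4 * k) (2 * k) : ℚ) * (Nat.choose (2 * k) k) / 64 ^ k * harm2 k)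
      (-(epoly (p - 3) (1 / 4))) := by
  have : Fact p.Prime := ⟨hp⟩
  have hp5 : 5 ≤ p := by
    rcases Nat.lt_or_ge p 5 with h | h
    · have : p = 4 := by omega
      subst this
      exact absurd hp (by norm_num)
    · exact h
  have hsum : ∑ k ∈ Finset.range p,
      (Nat.choose (4 * k) (2 * k) : ℚ) * (Nat.choose (2 * k) k) / 64 ^ k * harm2 k =
      harmSum p (-1 / 4) :=
    Finset.sum_congr rfl fun k _ => by rw [binomProd_neg_quarter]
  have hsq : 5 * p ≤ p ^ 2 := by nlinarith
  have ht : (p ^ 2).totient = p ^ 2 - p := by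
    rw [Nat.totient_prime_pow hp two_pos, Nat.mul_sub]
    simp [sq]
  rw [hsum]
  refine ⟨congrMod_harmSum_epoly (by omega) le_rfl (by omega) (by omega),
    congrMod_harmSum_epoly (by omega) one_le_two (by omega) ?_⟩
  rw [pow_one, Nat.totient_prime hp]
  omega
end

section
/- Let p > 3 be a prime. Then Σ_{k=0}^{p-1} binom(2k,k)²/16^k · H_k^{(2)} ≡ (1/4)·Σ_{k=0}^{p-1} binom(4k,2k)·binom(2k,k)/((2k+1)·64^k) · H_k^{(2)} ≡ (1/5)·Σ_{k=0}^{p-1} binom(6k,3k)·binom(3k,k)/432^k · H_k^{(2)} ≡ -4·E_{p²-p-2} (mod p²), and these quantities are ≡ -4·E_{p-3} (mod p). -/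
open Finset

section PadicCongruence

/-- `x` is `p`-integral. -/
def PInt (p : ℕ) (x : ℚ) : Prop := padicNorm p x ≤ 1

/-- `x ≡ y (mod p^m)`, expressed through the `p`-adic norm. -/
def PCong (p m : ℕ) (x y : ℚ) : Prop := padicNorm p (x - y) ≤ (p : ℚ) ^ (-(m : ℤ))

variable {p m : ℕ}

theorem PCong.refl (x : ℚ) : PCong p m x x := by
  simp only [PCong, sub_self, padicNorm.zero]; positivity

theorem PCong.of_eq {x y : ℚ} (h : x = y) : PCong p m x y := h ▸ PCong.refl x

theorem PCong.symm {x y : ℚ} (h : PCong p m x y) : PCong p m y x := by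
  unfold PCong at *
  rwa [← neg_sub, padicNorm.neg]

theorem PInt.neg {x : ℚ} (hx : PInt p x) : PInt p (-x) := by
  unfold PInt at *; rwa [padicNorm.neg]

variable [Fact p.Prime]

theorem PInt.intCast (z : ℤ) : PInt p z := padicNorm.of_int z

theorem PInt.natCast (n : ℕ) : PInt p n := padicNorm.of_nat n

theorem PInt.zero : PInt p 0 := by simpa using PInt.natCast (p := p) 0

theorem PInt.one : PInt p 1 := by simpa using PInt.natCast (p := p) 1

theorem PInt.two : PInt p 2 := by simpa using PInt.natCast (p := p) 2

theorem PInt.add {x y : ℚ} (hx : PInt p x) (hy : PInt p y) : PInt p (x + y) :=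
  padicNorm.nonarchimedean.trans (max_le hx hy)

theorem PInt.sub {x y : ℚ} (hx : PInt p x) (hy : PInt p y) : PInt p (x - y) :=
  padicNorm.sub.trans (max_le hx hy)

theorem PInt.mul {x y : ℚ} (hx : PInt p x) (hy : PInt p y) : PInt p (x * y) := by
  unfold PInt at *
  rw [padicNorm.mul]
  exact mul_le_one₀ hx (padicNorm.nonneg _) hy

theorem PInt.pow {x : ℚ} (hx : PInt p x) (n : ℕ) : PInt p (x ^ n) := by
  induction n with
  | zero => simpa using PInt.one
  | succ n ih => rw [pow_succ]; exact ih.mul hx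

theorem PInt.sum {ι : Type*} {s : Finset ι} {f : ι → ℚ} (h : ∀ i ∈ s, PInt p (f i)) :
    PInt p (∑ i ∈ s, f i) :=
  padicNorm.sum_le' h zero_le_one

theorem PInt.prod {ι : Type*} {s : Finset ι} {f : ι → ℚ} (h : ∀ i ∈ s, PInt p (f i)) :
    PInt p (∏ i ∈ s, f i) :=
  Finset.prod_induction f (PInt p) (fun _ _ => PInt.mul) PInt.one h

theorem PInt.inv_intCast {z : ℤ} (hz : ¬ (p : ℤ) ∣ z) : PInt p (z : ℚ)⁻¹ := by
  unfold PInt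
  rw [← one_div, padicNorm.div, (padicNorm.int_eq_one_iff z).2 hz]
  simp

theorem PInt.inv_natCast {n : ℕ} (hn : ¬ p ∣ n) : PInt p (n : ℚ)⁻¹ := by
  have := PInt.inv_intCast (p := p) (z := n) (by exact_mod_cast hn)
  simpa using this

theorem PInt.inv_natCast_of_lt {n : ℕ} (h0 : 0 < n) (hn : n < p) : PInt p (n : ℚ)⁻¹ :=
  PInt.inv_natCast (Nat.not_dvd_of_pos_of_lt h0 hn)

theorem PInt.half (hp2 : 2 < p) : PInt p (2 : ℚ)⁻¹ := by
  simpa using PInt.inv_natCast_of_lt (p := p) (n := 2) (by norm_num) hp2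

theorem PCong.trans {x y z : ℚ} (h : PCong p m x y) (h' : PCong p m y z) : PCong p m x z := by
  unfold PCong at *
  rw [← sub_add_sub_cancel x y z]
  exact padicNorm.nonarchimedean.trans (max_le h h')

theorem PCong.add {x y x' y' : ℚ} (h : PCong p m x y) (h' : PCong p m x' y') :
    PCong p m (x + x') (y + y') := by
  unfold PCong at *
  rw [add_sub_add_comm]
  exact padicNorm.nonarchimedean.trans (max_le h h')

theorem PCong.sub {x y x' y' : ℚ} (h : PCong p m x y) (h' : PCong p m x' y') :
    PCong p m (x - x') (y - y') := by
  unfold PCong at *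
  rw [sub_sub_sub_comm]
  exact padicNorm.sub.trans (max_le h h')

theorem PCong.const_mul {c x y : ℚ} (hc : PInt p c) (h : PCong p m x y) :
    PCong p m (c * x) (c * y) := by
  unfold PCong PInt at *
  rw [← mul_sub, padicNorm.mul]
  exact (mul_le_of_le_one_left (padicNorm.nonneg _) hc).trans h

theorem PCong.mul_const {c x y : ℚ} (hc : PInt p c) (h : PCong p m x y) :
    PCong p m (x * c) (y * c) := by
  simpa only [mul_comm] using h.const_mul hc

theorem PCong.mul {x y x' y' : ℚ} (hx : PInt p x) (hy' : PInt p y')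
    (h : PCong p m x y) (h' : PCong p m x' y') : PCong p m (x * x') (y * y') :=
  (h'.const_mul hx).trans (h.mul_const hy')

theorem PCong.sum {ι : Type*} {s : Finset ι} {f g : ι → ℚ}
    (h : ∀ i ∈ s, PCong p m (f i) (g i)) : PCong p m (∑ i ∈ s, f i) (∑ i ∈ s, g i) := by
  unfold PCong at *
  rw [← Finset.sum_sub_distrib]
  exact padicNorm.sum_le' h (by positivity)

theorem PCong.prod_range {n : ℕ} {f g : ℕ → ℚ} (hf : ∀ i < n, PInt p (f i))
    (hg : ∀ i < n, PInt p (g i)) (h : ∀ i < n, PCong p m (f i) (g i)) :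
    PCong p m (∏ i ∈ Finset.range n, f i) (∏ i ∈ Finset.range n, g i) := by
  induction n with
  | zero => simpa using PCong.refl 1
  | succ n ih =>
    rw [Finset.prod_range_succ, Finset.prod_range_succ]
    refine PCong.mul (PInt.prod fun i hi => hf i ?_) (hg n n.lt_succ_self)
      (ih (fun i hi => hf i (by omega)) (fun i hi => hg i (by omega))
        (fun i hi => h i (by omega))) (h n n.lt_succ_self)
    have := Finset.mem_range.1 hi
    omega

theorem PCong.pow {x y : ℚ} (hx : PInt p x) (hy : PInt p y) (h : PCong p m x y) (n : ℕ) :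
    PCong p m (x ^ n) (y ^ n) := by
  simpa using PCong.prod_range (n := n) (f := fun _ => x) (g := fun _ => y)
    (fun _ _ => hx) (fun _ _ => hy) (fun _ _ => h)

theorem PCong.intCast {a b : ℤ} (h : (p : ℤ) ^ m ∣ a - b) : PCong p m a b := by
  have := (padicNorm.dvd_iff_norm_le (p := p) (n := m) (z := a - b)).1 (by exact_mod_cast h)
  simpa [PCong] using this

theorem PCong.of_le {m' : ℕ} (hm : m' ≤ m) {x y : ℚ} (h : PCong p m x y) : PCong p m' x y := by
  refine le_trans h ?_
  have hp : (1 : ℚ) ≤ p := by exact_mod_cast (Fact.out : p.Prime).one_lt.le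
  exact zpow_le_zpow_right₀ hp (by omega)

theorem PCong.congrMod {x y : ℚ} (h : PCong p m x y) : CongrMod p m x y := by
  by_cases hxy : x = y
  · exact Or.inl hxy
  · right
    unfold PCong at h
    have hp : (1 : ℚ) < p := by exact_mod_cast (Fact.out : p.Prime).one_lt
    rw [padicNorm.eq_zpow_of_nonzero (sub_ne_zero.2 hxy), zpow_le_zpow_iff_right₀ hp] at h
    omega

end PadicCongruence

section InverseSquares

/-- `1/j²` if `p ∤ j`, and `0` otherwise. -/
def invSq (p : ℕ) (j : ℤ) : ℚ := if (p : ℤ) ∣ j then 0 else ((j : ℚ)⁻¹) ^ 2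

variable {p m : ℕ}

theorem invSq_zero : invSq p 0 = 0 := by simp [invSq]

theorem invSq_neg (j : ℤ) : invSq p (-j) = invSq p j := by simp [invSq, inv_neg]

theorem not_dvd_of_pos_of_lt_prime {c : ℕ} (h0 : 0 < c) (hc : c < p) : ¬ (p : ℤ) ∣ (c : ℤ) := by
  exact_mod_cast Nat.not_dvd_of_pos_of_lt h0 hc

/-- `∑_{j=1}^n 1/j²` over `j` prime to `p`. -/
def invSqSum (p n : ℕ) : ℚ := ∑ i ∈ Finset.range n, invSq p (i + 1)

/-- `∑_{j=1}^n (-1)^j/j²` over `j` prime to `p`. -/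
def altInvSqSum (p n : ℕ) : ℚ := ∑ i ∈ Finset.range n, (-1) ^ (i + 1) * invSq p (i + 1)

theorem sum_invSq_range_succ (n : ℕ) :
    ∑ i ∈ Finset.range (n + 1), invSq p i = invSqSum p n := by
  rw [Finset.sum_range_succ', invSqSum]
  simp [invSq_zero]

theorem sum_range_two_mul {F : ℕ → ℚ} (n : ℕ) :
    ∑ i ∈ Finset.range (2 * n), F i =
      ∑ i ∈ Finset.range n, F (2 * i) + ∑ i ∈ Finset.range n, F (2 * i + 1) := by
  induction n with
  | zero => simp
  | succ n ih =>
    rw [show 2 * (n + 1) = 2 * n + 1 + 1 by ring]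
    simp only [Finset.sum_range_succ, ih]
    ring

theorem sum_range_three_mul {F : ℕ → ℚ} (n : ℕ) :
    ∑ i ∈ Finset.range (3 * n), F i =
      ∑ i ∈ Finset.range n, F (3 * i) + ∑ i ∈ Finset.range n, F (3 * i + 1) +
        ∑ i ∈ Finset.range n, F (3 * i + 2) := by
  induction n with
  | zero => simp
  | succ n ih =>
    rw [show 3 * (n + 1) = 3 * n + 1 + 1 + 1 by ring]
    simp only [Finset.sum_range_succ, ih]
    ring

variable [Fact p.Prime]

theorem invSq_mul {c : ℤ} (hc : ¬ (p : ℤ) ∣ c) (j : ℤ) :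
    invSq p (c * j) = ((c : ℚ)⁻¹) ^ 2 * invSq p j := by
  have hp : Prime (p : ℤ) := Nat.prime_iff_prime_int.1 Fact.out
  unfold invSq
  by_cases h : (p : ℤ) ∣ j
  · simp [h, dvd_mul_of_dvd_right h]
  · have : ¬ (p : ℤ) ∣ c * j := fun h' => (hp.dvd_or_dvd h').elim hc h
    simp only [h, this, if_false]
    push_cast
    rw [mul_inv, mul_pow]

theorem PInt.invSq (j : ℤ) : PInt p (invSq p j) := by
  unfold _root_.invSq
  split_ifs with h
  · exact PInt.zero
  · exact (PInt.inv_intCast h).pow 2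

theorem invSq_congr (hm : m ≠ 0) {i j : ℤ} (h : (p : ℤ) ^ m ∣ i - j) :
    PCong p m (invSq p i) (invSq p j) := by
  have hij : (p : ℤ) ∣ i ↔ (p : ℤ) ∣ j :=
    (dvd_iff_dvd_of_dvd_sub ((dvd_pow_self _ hm).trans h))
  unfold invSq
  by_cases hj : (p : ℤ) ∣ j
  · rw [if_pos (hij.2 hj), if_pos hj]; exact PCong.refl _
  · have hi := mt hij.1 hj
    rw [if_neg hi, if_neg hj]
    refine PCong.pow (PInt.inv_intCast hi) (PInt.inv_intCast hj) ?_ 2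
    have hi0 : (i : ℚ) ≠ 0 := by
      rintro h0; exact hi (by simp [Int.cast_eq_zero.1 h0])
    have hj0 : (j : ℚ) ≠ 0 := by
      rintro h0; exact hj (by simp [Int.cast_eq_zero.1 h0])
    have := ((PCong.intCast h).symm.mul_const (PInt.inv_intCast hi)).mul_const
      (PInt.inv_intCast hj)
    convert this using 1 <;> field_simp

theorem invSq_congr_neg (hm : m ≠ 0) {i j : ℤ} (h : (p : ℤ) ^ m ∣ i + j) :
    PCong p m (invSq p i) (invSq p j) := by
  rw [← invSq_neg j]
  exact invSq_congr hm (by simpa using h)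

theorem sum_range_shift_congr {Q : ℕ} {F : ℤ → ℚ} (hF : ∀ i, PCong p m (F (i + Q)) (F i)) (c : ℕ) :
    PCong p m (∑ i ∈ Finset.range Q, F (i + c)) (∑ i ∈ Finset.range Q, F i) := by
  induction c with
  | zero => simpa using PCong.refl _
  | succ c ih =>
    have h : ∑ i ∈ Finset.range Q, F (i + (c + 1 : ℕ)) =
        ∑ i ∈ Finset.range Q, F (i + c) + F (c + Q) - F c := by
      have h1 := Finset.sum_range_succ (fun i : ℕ => F (i + c)) Q
      rw [Finset.sum_range_succ'] at h1
      have h2 : ∀ i : ℕ, F ((i + 1 : ℕ) + c) = F (i + (c + 1 : ℕ)) := fun i => by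
        congr 1; push_cast; ring
      simp only [h2] at h1
      rw [add_comm (c : ℤ), ← h1]
      simp
    rw [h]
    have := (ih.add (hF c)).sub (PCong.refl (F c))
    simpa using this

theorem sum_invSq_full_congr_zero (hp3 : 3 < p) (hm : m ≠ 0) {h : ℕ} (hh : p ^ m = 2 * h + 1) :
    PCong p m (∑ i ∈ Finset.range (p ^ m), invSq p i) 0 := by
  have h2 := not_dvd_of_pos_of_lt_prime (p := p) (c := 2) (by norm_num) (by omega)
  push_cast at h2
  set Q := p ^ m with hQ
  have hQ' : (p : ℤ) ^ m = Q := by rw [hQ]; push_cast; rfl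
  have hper : ∀ i : ℤ, PCong p m (invSq p (i + Q)) (invSq p i) := fun i =>
    invSq_congr hm (by rw [hQ']; simp)
  set S := ∑ i ∈ Finset.range Q, invSq p i with hS
  have e1 : PCong p m (∑ i ∈ Finset.range (2 * Q), invSq p i) (S + S) := by
    rw [two_mul, Finset.sum_range_add]
    refine (PCong.refl _).add (PCong.sum fun i _ => ?_)
    have := hper i
    rwa [add_comm] at this
  have e2 : PCong p m (∑ i ∈ Finset.range (2 * Q), invSq p i)
      (((2 : ℚ)⁻¹) ^ 2 * S + ((2 : ℚ)⁻¹) ^ 2 * S) := by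
    rw [sum_range_two_mul]
    refine PCong.add (PCong.of_eq ?_) (PCong.trans (y := ∑ i ∈ Finset.range Q,
      ((2 : ℚ)⁻¹) ^ 2 * invSq p (i + (h + 1 : ℕ))) ?_ ?_)
    · rw [hS, Finset.mul_sum]
      refine Finset.sum_congr rfl fun i _ => ?_
      have := invSq_mul h2 i
      push_cast at this ⊢
      exact this
    · refine PCong.sum fun i _ => ?_
      have := invSq_mul h2 (i + (h + 1 : ℕ))
      push_cast at this ⊢
      rw [← this]
      refine invSq_congr hm ⟨-1, ?_⟩
      rw [hQ', hh]; push_cast; ring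
    · rw [← Finset.mul_sum]
      refine (sum_range_shift_congr hper _).const_mul (PInt.pow ?_ 2)
      simpa using PInt.inv_intCast h2
  have h3 : PInt p (3 : ℚ)⁻¹ := by
    simpa using PInt.inv_natCast_of_lt (p := p) (n := 3) (by norm_num) hp3
  have e3 := (((e1.symm.trans e2).sub (PCong.refl ((2 : ℚ)⁻¹ * S))).const_mul
    (PInt.two (p := p))).const_mul h3
  convert e3 using 1 <;> ring

theorem invSqSum_half_congr_zero (hp3 : 3 < p) (hm : m ≠ 0) {h : ℕ} (hh : p ^ m = 2 * h + 1) :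
    PCong p m (invSqSum p h) 0 := by
  have hQ' : (p : ℤ) ^ m = 2 * h + 1 := by exact_mod_cast hh
  have e := sum_invSq_full_congr_zero hp3 hm hh
  rw [hh, sum_invSq_range_succ] at e
  have e2 : PCong p m (invSqSum p (2 * h)) (invSqSum p h + invSqSum p h) := by
    rw [invSqSum, two_mul, Finset.sum_range_add]
    refine (PCong.refl _).add ?_
    rw [← Finset.sum_range_reflect, invSqSum]
    refine PCong.sum fun i hi => invSq_congr_neg hm ⟨1, ?_⟩
    have := Finset.mem_range.1 hi
    rw [hQ']; push_cast [show 1 ≤ h by omega, show i ≤ h - 1 by omega]; ring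
  have e3 := (e2.symm.trans e).const_mul (PInt.half (by omega))
  convert e3 using 1 <;> ring

theorem altInvSqSum_add_invSqSum (hp2 : 2 < p) (n : ℕ) :
    altInvSqSum p (2 * n) + invSqSum p (2 * n) = 2⁻¹ * invSqSum p n := by
  have h2 := not_dvd_of_pos_of_lt_prime (p := p) (c := 2) (by norm_num) hp2
  simp only [altInvSqSum, invSqSum]
  rw [← Finset.sum_add_distrib, sum_range_two_mul, Finset.mul_sum, Finset.sum_eq_zero, zero_add]
  · refine Finset.sum_congr rfl fun i _ => ?_
    have := invSq_mul h2 (i + 1)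
    rw [show ((2 * i + 1 : ℕ) : ℤ) + 1 = (2 : ℕ) * (i + 1) by push_cast; ring, this]
    rw [show 2 * i + 1 + 1 = 2 * (i + 1) by ring, pow_mul]
    norm_num
    ring
  · intro i _
    rw [pow_succ, pow_mul]
    norm_num

theorem invSqSum_quarter_congr (hp3 : 3 < p) (hm : m ≠ 0) {n : ℕ} (hn : p ^ m = 4 * n + 1) :
    PCong p m (invSqSum p n) (2 * altInvSqSum p (2 * n)) := by
  have e := invSqSum_half_congr_zero hp3 hm (h := 2 * n) (by omega)
  have e1 := altInvSqSum_add_invSqSum (p := p) (by omega) n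
  have e2 := ((PCong.refl (p := p) (m := m) (altInvSqSum p (2 * n))).add e).const_mul
    (PInt.two (p := p))
  rw [e1] at e2
  convert e2 using 1 <;> ring

theorem altInvSqSum_sixth_congr (hp3 : 3 < p) (hm : m ≠ 0) {n : ℕ} (hn : p ^ m = 6 * n + 1) :
    PCong p m (altInvSqSum p n) (5 * altInvSqSum p (3 * n)) := by
  have h3 := not_dvd_of_pos_of_lt_prime (p := p) (c := 3) (by norm_num) hp3
  have hQ : (p : ℤ) ^ m = 6 * n + 1 := by exact_mod_cast hn
  have hi3 : PInt p (3 : ℚ)⁻¹ := by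
    simpa using PInt.inv_intCast h3
  have hs : ∀ k, PInt p ((-1 : ℚ) ^ k) := fun k => PInt.one.neg.pow k
  set f : ℕ → ℚ := fun i => (-1) ^ (i + 1) * invSq p (i + 1) with hf
  have hsum : altInvSqSum p (3 * n) = altInvSqSum p n + ∑ i ∈ Finset.range n, f (n + i) +
      ∑ i ∈ Finset.range n, f (2 * n + i) := by
    rw [altInvSqSum, show 3 * n = n + n + n by ring, Finset.sum_range_add, Finset.sum_range_add,
      altInvSqSum, two_mul]
  have e : PCong p m (altInvSqSum p (3 * n)) (-(3⁻¹) ^ 2 * ∑ i ∈ Finset.range n, f (n + i) +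
      -(3⁻¹) ^ 2 * ∑ i ∈ Finset.range n, f (2 * n + i) + (3⁻¹) ^ 2 * altInvSqSum p n) := by
    rw [altInvSqSum, sum_range_three_mul]
    refine (PCong.add ?_ ?_).add ?_
    · rw [← Finset.sum_range_reflect, Finset.mul_sum]
      refine PCong.sum fun i hi => ?_
      have hi := Finset.mem_range.1 hi
      have h := invSq_mul h3 (n + i + 1)
      obtain ⟨j, hj⟩ : ∃ j, n = i + 1 + j := ⟨n - 1 - i, by omega⟩
      have hsign : (-1 : ℚ) ^ (3 * (n - 1 - i) + 1) = -(-1) ^ (n + i + 1) := by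
        rw [show n - 1 - i = j by omega, pow_succ, pow_mul]
        have : (-1 : ℚ) ^ (n + i + 1) = (-1) ^ j := by
          rw [hj, show i + 1 + j + i + 1 = j + 2 * (i + 1) by ring, pow_add, pow_mul]; norm_num
        rw [this]; norm_num
      rw [hsign, hf]
      have : -(3 : ℚ)⁻¹ ^ 2 * ((-1) ^ (n + i + 1) * invSq p ((n + i : ℕ) + 1)) =
          -(-1) ^ (n + i + 1) * invSq p ((3 : ℕ) * (n + i + 1)) := by
        rw [h]; push_cast; ring
      simp only
      rw [this]
      refine (invSq_congr_neg hm ⟨1, ?_⟩).const_mul (hs _).neg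
      rw [hQ, show n - 1 - i = j by omega, hj]; push_cast; ring
    · rw [Finset.mul_sum]
      refine PCong.sum fun i hi => ?_
      have h := invSq_mul h3 (2 * n + i + 1)
      have hsign : (-1 : ℚ) ^ (3 * i + 1 + 1) = -(-1) ^ (2 * n + i + 1) := by
        rw [show 3 * i + 1 + 1 = i + 2 * (i + 1) by ring, add_assoc (2 * n), pow_add, pow_mul,
          pow_add _ (2 * n), pow_mul, pow_succ]
        norm_num
        ring
      have : -(3 : ℚ)⁻¹ ^ 2 * ((-1) ^ (2 * n + i + 1) * invSq p ((2 * n + i : ℕ) + 1)) =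
          -(-1) ^ (2 * n + i + 1) * invSq p ((3 : ℕ) * (2 * n + i + 1)) := by
        rw [h]; push_cast; ring
      rw [hsign, hf]
      simp only
      rw [this]
      refine (invSq_congr hm ⟨-1, ?_⟩).const_mul (hs _).neg
      rw [hQ]; push_cast; ring
    · rw [altInvSqSum, Finset.mul_sum]
      refine PCong.of_eq (Finset.sum_congr rfl fun i _ => ?_)
      have h := invSq_mul h3 (i + 1)
      rw [show ((3 * i + 2 : ℕ) : ℤ) + 1 = (3 : ℕ) * (i + 1) by push_cast; ring, h,
        show 3 * i + 2 + 1 = 3 * (i + 1) by ring, pow_mul]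
      norm_num
      ring
  have e' := ((e.const_mul (PInt.natCast 9)).add
    (PCong.refl (altInvSqSum p (3 * n)))).const_mul (PInt.half (by omega))
  rw [hsum] at e'
  rw [hsum]
  convert e'.symm using 1 <;> push_cast <;> ring

end InverseSquares

section BinomialSums

/-- `C(a,k)·C(-1-a,k)` in product form. -/
def doubleBinom (k : ℕ) (a : ℚ) : ℚ :=
  ∏ i ∈ Finset.range k, ((i - a) * (i + 1 + a) * (((i + 1 : ℕ) : ℚ)⁻¹) ^ 2)

/-- `∏_{i=1}^k (1 - a²/i²)`. -/
def oneSubSqProd (k : ℕ) (a : ℚ) : ℚ :=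
  ∏ i ∈ Finset.range k, ((i + 1 - a) * (i + 1 + a) * (((i + 1 : ℕ) : ℚ)⁻¹) ^ 2)

theorem oneSubSqProd_succ (k : ℕ) (a : ℚ) : oneSubSqProd (k + 1) a =
    oneSubSqProd k a * ((k + 1 - a) * (k + 1 + a) * (((k + 1 : ℕ) : ℚ)⁻¹) ^ 2) :=
  Finset.prod_range_succ _ _

theorem doubleBinom_succ (k : ℕ) (a : ℚ) : doubleBinom (k + 1) a =
    -a * (a + (k + 1)) * oneSubSqProd k a * (((k + 1 : ℕ) : ℚ)⁻¹) ^ 2 := by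
  induction k with
  | zero =>
    rw [doubleBinom, oneSubSqProd, Finset.prod_range_one, Finset.prod_range_zero]
    push_cast
    ring
  | succ k ih =>
    rw [doubleBinom, Finset.prod_range_succ, ← doubleBinom, ih, oneSubSqProd_succ]
    push_cast
    ring

theorem doubleBinom_pred (k : ℕ) (a : ℚ) : doubleBinom k (a - 1) = doubleBinom k (-a) := by
  refine Finset.prod_congr rfl fun i _ => ?_
  ring

theorem oneSubSqProd_neg (k : ℕ) (a : ℚ) : oneSubSqProd k (-a) = oneSubSqProd k a := by
  refine Finset.prod_congr rfl fun i _ => ?_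
  ring

/-- The increment `∑_{k=1}^n (C(a,k)C(-1-a,k) + C(a-1,k)C(-a,k)) H_k^{(2)}`. -/
def binomIncrement (n : ℕ) (a : ℚ) : ℚ :=
  ∑ k ∈ Finset.range n,
    -2 * a ^ 2 * oneSubSqProd k a * (((k + 1 : ℕ) : ℚ)⁻¹) ^ 2 * harm2 (k + 1)

/-- `∑_{k=0}^n C(a,k)C(-1-a,k) H_k^{(2)}`. -/
def binomHarmSum (n : ℕ) (a : ℚ) : ℚ :=
  ∑ k ∈ Finset.range (n + 1), doubleBinom k a * harm2 k

/-- `∑_{k=0}^n C(a,k)C(-1-a,k) H_k^{(2)}/(2k+1)`. -/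
def binomHarmDivSum (n : ℕ) (a : ℚ) : ℚ :=
  ∑ k ∈ Finset.range (n + 1), doubleBinom k a * (harm2 k / (2 * k + 1))

theorem harm2_zero : harm2 0 = 0 := rfl

theorem harm2_succ (k : ℕ) : harm2 (k + 1) = harm2 k + (((k + 1 : ℕ) : ℚ)⁻¹) ^ 2 := by
  rw [harm2, Finset.sum_range_succ, ← harm2]
  push_cast
  rw [one_div, inv_pow]

theorem binomHarmSum_zero (n : ℕ) : binomHarmSum n 0 = 0 := by
  rw [binomHarmSum, Finset.sum_range_succ', harm2_zero, mul_zero, add_zero]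
  refine Finset.sum_eq_zero fun k _ => ?_
  rw [doubleBinom_succ]
  simp

theorem binomHarmDivSum_zero (n : ℕ) : binomHarmDivSum n 0 = 0 := by
  rw [binomHarmDivSum, Finset.sum_range_succ', harm2_zero, zero_div, mul_zero, add_zero]
  refine Finset.sum_eq_zero fun k _ => ?_
  rw [doubleBinom_succ]
  simp

theorem binomHarmSum_add_pred (n : ℕ) (a : ℚ) :
    binomHarmSum n a + binomHarmSum n (a - 1) = binomIncrement n a := by
  rw [binomHarmSum, binomHarmSum, ← Finset.sum_add_distrib, Finset.sum_range_succ', harm2_zero,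
    mul_zero, mul_zero, add_zero, add_zero, binomIncrement]
  refine Finset.sum_congr rfl fun k _ => ?_
  rw [doubleBinom_pred, doubleBinom_succ, doubleBinom_succ, oneSubSqProd_neg]
  ring

theorem binomHarmDivSum_sub_pred (n : ℕ) (a : ℚ) :
    (2 * a + 1) * binomHarmDivSum n a - (2 * (a - 1) + 1) * binomHarmDivSum n (a - 1) =
      binomIncrement n a := by
  rw [binomHarmDivSum, binomHarmDivSum, Finset.mul_sum, Finset.mul_sum, ← Finset.sum_sub_distrib,
    Finset.sum_range_succ', harm2_zero, zero_div, mul_zero, mul_zero, mul_zero, mul_zero,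
    sub_zero, add_zero, binomIncrement]
  refine Finset.sum_congr rfl fun k _ => ?_
  rw [doubleBinom_pred, doubleBinom_succ, doubleBinom_succ, oneSubSqProd_neg]
  have h : (2 * (k + 1 : ℕ) + 1 : ℚ) ≠ 0 := by positivity
  field_simp
  push_cast
  ring

theorem binomIncrement_eq (n : ℕ) {a : ℚ} (ha : a ≠ 0) :
    binomIncrement n a =
      2 * (oneSubSqProd n a * (harm2 n + (a⁻¹) ^ 2)) - 2 * (a⁻¹) ^ 2 := by
  induction n with
  | zero => simp [binomIncrement, oneSubSqProd, harm2_zero]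
  | succ n ih =>
    rw [binomIncrement, Finset.sum_range_succ, ← binomIncrement, ih, harm2_succ,
      oneSubSqProd_succ]
    have h : ((n + 1 : ℕ) : ℚ) ≠ 0 := by positivity
    field_simp
    push_cast
    ring

variable {p : ℕ}

theorem harm2_eq_invSqSum {k : ℕ} (hk : k < p) : harm2 k = invSqSum p k := by
  refine Finset.sum_congr rfl fun i hi => ?_
  have hi := Finset.mem_range.1 hi
  have := not_dvd_of_pos_of_lt_prime (p := p) (c := i + 1) (by omega) (by omega)
  push_cast at this
  rw [invSq, if_neg this]
  push_cast
  rw [one_div, inv_pow]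

variable [Fact p.Prime]

theorem PInt.inv_succ {i : ℕ} (hi : i + 1 < p) : PInt p (((i + 1 : ℕ) : ℚ)⁻¹) :=
  PInt.inv_natCast_of_lt (Nat.succ_pos i) hi

theorem PInt.harm2 {k : ℕ} (hk : k < p) : PInt p (harm2 k) := by
  induction k with
  | zero => exact PInt.zero
  | succ k ih =>
    rw [harm2_succ]
    exact (ih (by omega)).add ((PInt.inv_succ hk).pow 2)

theorem PInt.oneSubSqProd {k : ℕ} (hk : k < p) {a : ℚ} (ha : PInt p a) :
    PInt p (oneSubSqProd k a) := by
  refine PInt.prod fun i hi => ?_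
  have hi := Finset.mem_range.1 hi
  have h : PInt p ((i : ℚ) + 1) := (PInt.natCast i).add PInt.one
  exact ((h.sub ha).mul (h.add ha)).mul ((PInt.inv_succ (by omega)).pow 2)

theorem PInt.doubleBinom {k : ℕ} (hk : k < p) {a : ℚ} (ha : PInt p a) :
    PInt p (doubleBinom k a) := by
  refine PInt.prod fun i hi => ?_
  have hi := Finset.mem_range.1 hi
  exact (((PInt.natCast i).sub ha).mul (((PInt.natCast i).add PInt.one).add ha)).mul
    ((PInt.inv_succ (by omega)).pow 2)

theorem doubleBinom_congr {m k : ℕ} (hk : k < p) {a b : ℚ} (ha : PInt p a) (hb : PInt p b)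
    (h : PCong p m a b) : PCong p m (doubleBinom k a) (doubleBinom k b) := by
  have hf : ∀ c, PInt p c → ∀ i < k,
      PInt p ((i - c) * (i + 1 + c) * (((i + 1 : ℕ) : ℚ)⁻¹) ^ 2) := fun c hc i hi =>
    (((PInt.natCast i).sub hc).mul (((PInt.natCast i).add PInt.one).add hc)).mul
      ((PInt.inv_succ (by omega)).pow 2)
  refine PCong.prod_range (hf a ha) (hf b hb) fun i hi => ?_
  refine PCong.mul_const ((PInt.inv_succ (by omega)).pow 2) ?_
  exact PCong.mul ((PInt.natCast i).sub ha) (((PInt.natCast i).add PInt.one).add hb)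
    ((PCong.refl _).sub h) ((PCong.refl _).add h)

theorem sum_doubleBinom_congr {m : ℕ} {c : ℕ → ℚ} (hc : ∀ k < p, PInt p (c k)) {a b : ℚ}
    (ha : PInt p a) (hb : PInt p b) (h : PCong p m a b) :
    PCong p m (∑ k ∈ Finset.range (p - 1 + 1), doubleBinom k a * c k)
      (∑ k ∈ Finset.range (p - 1 + 1), doubleBinom k b * c k) := by
  have hp := (Fact.out : p.Prime).pos
  refine PCong.sum fun k hk => ?_
  have hk : k < p := by have := Finset.mem_range.1 hk; omega
  exact (doubleBinom_congr hk ha hb h).mul_const (hc k hk)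

theorem prod_range_dvd_of_not_dvd {j : ℤ} (hj : ¬ (p : ℤ) ∣ j) :
    (p : ℤ) ∣ ∏ i ∈ Finset.range (p - 1), ((i : ℤ) + 1 - j) := by
  have hp := (Fact.out : p.Prime).pos
  have h0 : 0 ≤ j % p := Int.emod_nonneg _ (by omega)
  have h1 : j % p < p := Int.emod_lt_of_pos _ (by omega)
  have h2 : j % p ≠ 0 := fun h => hj (Int.dvd_of_emod_eq_zero h)
  obtain ⟨i, hi⟩ : ∃ i : ℕ, (i : ℤ) + 1 = j % p := ⟨(j % p - 1).toNat, by omega⟩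
  refine dvd_trans ?_ (Finset.dvd_prod_of_mem _ (Finset.mem_range.2 (show i < p - 1 by omega)))
  rw [hi]
  exact (Int.mod_modEq j p).symm.dvd

theorem oneSubSqProd_congr_zero {j : ℤ} (hj : ¬ (p : ℤ) ∣ j) :
    PCong p 2 (oneSubSqProd (p - 1) j) 0 := by
  have h1 := prod_range_dvd_of_not_dvd hj
  have h2 := prod_range_dvd_of_not_dvd (p := p) (j := -j) (by simpa using hj)
  have h3 : PCong p 2 ((((∏ i ∈ Finset.range (p - 1), ((i : ℤ) + 1 - j)) *
      ∏ i ∈ Finset.range (p - 1), ((i : ℤ) + 1 - -j) : ℤ)) : ℚ) ((0 : ℤ) : ℚ) := by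
    refine PCong.intCast ?_
    rw [sub_zero, pow_two]
    exact mul_dvd_mul h1 h2
  have h4 : PInt p (∏ i ∈ Finset.range (p - 1), (((i + 1 : ℕ) : ℚ)⁻¹) ^ 2) := by
    refine PInt.prod fun i hi => (PInt.inv_succ ?_).pow 2
    have := Finset.mem_range.1 hi
    omega
  have h5 := h3.mul_const h4
  rw [Int.cast_zero, zero_mul] at h5
  convert h5 using 1
  push_cast
  rw [oneSubSqProd, ← Finset.prod_mul_distrib, ← Finset.prod_mul_distrib]
  simp

theorem binomIncrement_congr (j : ℤ) :
    PCong p 2 (binomIncrement (p - 1) j) (-2 * invSq p j) := by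
  have hp := (Fact.out : p.Prime).pos
  by_cases hj : (p : ℤ) ∣ j
  · rw [invSq, if_pos hj, mul_zero, binomIncrement, ← Finset.sum_const_zero]
    refine PCong.sum fun k hk => ?_
    have hk : k + 1 < p := by have := Finset.mem_range.1 hk; omega
    have h : PCong p 2 ((j ^ 2 : ℤ) : ℚ) ((0 : ℤ) : ℚ) :=
      PCong.intCast (by rw [sub_zero]; exact pow_dvd_pow_of_dvd hj 2)
    push_cast at h
    have h' := (((h.const_mul PInt.two.neg).mul_const
      (PInt.oneSubSqProd (k := k) (by omega) (PInt.intCast j))).mul_const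
        ((PInt.inv_succ hk).pow 2)).mul_const (PInt.harm2 hk)
    simpa using h'
  · have hj0 : (j : ℚ) ≠ 0 := by
      rintro h0; exact hj (by simp [Int.cast_eq_zero.1 h0])
    rw [invSq, if_neg hj, binomIncrement_eq _ hj0]
    have h := (((oneSubSqProd_congr_zero hj).mul_const
      ((PInt.harm2 (p := p) (k := p - 1) (by omega)).add
        ((PInt.inv_intCast hj).pow 2))).const_mul PInt.two).sub
          (PCong.refl (2 * (j : ℚ)⁻¹ ^ 2))
    convert h using 1
    ring

theorem binomHarmSum_natCast_congr (n : ℕ) :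
    PCong p 2 (binomHarmSum (p - 1) n) (-2 * ((-1) ^ n * altInvSqSum p n)) := by
  induction n with
  | zero => simpa [binomHarmSum_zero, altInvSqSum] using PCong.refl 0
  | succ n ih =>
    have h := (binomIncrement_congr (p := p) (n + 1 : ℕ)).sub ih
    convert h using 1
    · rw [eq_sub_iff_add_eq]
      have := binomHarmSum_add_pred (p - 1) (n + 1 : ℕ)
      push_cast at this ⊢
      rwa [add_sub_cancel_right] at this
    · rw [altInvSqSum, Finset.sum_range_succ, ← altInvSqSum]
      have h1 : (-1 : ℚ) ^ n * (-1) ^ n = 1 := by rw [← mul_pow]; norm_num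
      push_cast
      linear_combination (-2 * invSq p (n + 1)) * h1

theorem binomHarmDivSum_natCast_congr (n : ℕ) :
    PCong p 2 ((2 * n + 1) * binomHarmDivSum (p - 1) n) (-2 * invSqSum p n) := by
  induction n with
  | zero => simpa [binomHarmDivSum_zero, invSqSum] using PCong.refl 0
  | succ n ih =>
    have h := (binomIncrement_congr (p := p) (n + 1 : ℕ)).add ih
    convert h using 1
    · rw [← sub_eq_iff_eq_add]
      have := binomHarmDivSum_sub_pred (p - 1) (n + 1 : ℕ)
      push_cast at this ⊢
      rwa [add_sub_cancel_right] at this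
    · rw [invSqSum, Finset.sum_range_succ, ← invSqSum]
      push_cast
      ring

theorem PInt.harm2_div (hp3 : 3 < p) {k : ℕ} (hk : k < p) :
    PInt p (_root_.harm2 k / (2 * k + 1)) := by
  by_cases h : p ∣ 2 * k + 1
  · obtain ⟨c, hc⟩ := h
    have hc1 : c = 1 := by
      have h1 : c < 2 := by
        by_contra! h'
        nlinarith
      interval_cases c
      · omega
      · rfl
    subst hc1
    have hpk : p ^ 1 = 2 * k + 1 := by rw [pow_one]; omega
    have h0 := invSqSum_half_congr_zero hp3 one_ne_zero hpk
    rw [← harm2_eq_invSqSum hk, PCong, sub_zero] at h0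
    unfold PInt
    have hp0 : (p : ℚ) ≠ 0 := by positivity
    rw [show (2 * k + 1 : ℚ) = p by rw [pow_one] at hpk; exact_mod_cast hpk.symm, padicNorm.div,
      padicNorm.padicNorm_p_of_prime]
    refine (div_le_one (by positivity)).2 ?_
    simpa using h0
  · rw [div_eq_mul_inv]
    have := PInt.inv_natCast h
    push_cast at this
    exact (PInt.harm2 hk).mul this

end BinomialSums

section BinomialIdentities

theorem centralBinom_sq_div (k : ℕ) :
    (Nat.choose (2 * k) k : ℚ) ^ 2 / 16 ^ k = doubleBinom k (-((2 : ℕ) : ℚ)⁻¹) := by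
  rw [← Nat.centralBinom_eq_two_mul_choose]
  induction k with
  | zero => simp [doubleBinom]
  | succ k ih =>
    have h : ((k : ℚ) + 1) * Nat.centralBinom (k + 1) = 2 * (2 * k + 1) * Nat.centralBinom k := by
      exact_mod_cast Nat.succ_mul_centralBinom_succ k
    have h' : (Nat.centralBinom (k + 1) : ℚ) = 2 * (2 * k + 1) * Nat.centralBinom k / (k + 1) := by
      field_simp; linarith
    rw [doubleBinom, Finset.prod_range_succ, ← doubleBinom, ← ih, h']
    push_cast
    field_simp
    ring

theorem centralBinom_mul_div (k : ℕ) :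
    (Nat.choose (4 * k) (2 * k) : ℚ) * (Nat.choose (2 * k) k) / 64 ^ k =
      doubleBinom k (-((4 : ℕ) : ℚ)⁻¹) := by
  rw [show 4 * k = 2 * (2 * k) by ring, ← Nat.centralBinom_eq_two_mul_choose,
    ← Nat.centralBinom_eq_two_mul_choose]
  induction k with
  | zero => simp [doubleBinom]
  | succ k ih =>
    have h (n : ℕ) :
        (Nat.centralBinom (n + 1) : ℚ) = 2 * (2 * n + 1) * Nat.centralBinom n / (n + 1) := by
      have : ((n : ℚ) + 1) * Nat.centralBinom (n + 1) = 2 * (2 * n + 1) * Nat.centralBinom n := by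
        exact_mod_cast Nat.succ_mul_centralBinom_succ n
      field_simp; linarith
    rw [doubleBinom, Finset.prod_range_succ, ← doubleBinom, ← ih,
      show 2 * (k + 1) = 2 * k + 1 + 1 by ring, h, h, h]
    push_cast
    field_simp
    ring

theorem choose_mul_choose_div (k : ℕ) :
    (Nat.choose (6 * k) (3 * k) : ℚ) * (Nat.choose (3 * k) k) / 432 ^ k =
      doubleBinom k (-((6 : ℕ) : ℚ)⁻¹) := by
  have h (k : ℕ) : (Nat.choose (6 * k) (3 * k) : ℚ) * (Nat.choose (3 * k) k) =
      (6 * k).factorial / ((3 * k).factorial * k.factorial * (2 * k).factorial) := by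
    rw [Nat.cast_choose ℚ (show 3 * k ≤ 6 * k by omega),
      Nat.cast_choose ℚ (show k ≤ 3 * k by omega), show 6 * k - 3 * k = 3 * k by omega,
      show 3 * k - k = 2 * k by omega]
    have := Nat.factorial_ne_zero
    field_simp
  rw [h]
  induction k with
  | zero => simp [doubleBinom]
  | succ k ih =>
    rw [doubleBinom, Finset.prod_range_succ, ← doubleBinom, ← ih,
      show 6 * (k + 1) = 6 * k + 1 + 1 + 1 + 1 + 1 + 1 by ring,
      show 3 * (k + 1) = 3 * k + 1 + 1 + 1 by ring, show 2 * (k + 1) = 2 * k + 1 + 1 by ring]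
    simp only [Nat.factorial_succ]
    push_cast
    have h1 : ((6 * k).factorial : ℚ) ≠ 0 := by positivity
    have h2 : ((3 * k).factorial : ℚ) ≠ 0 := by positivity
    have h3 : ((2 * k).factorial : ℚ) ≠ 0 := by positivity
    have h4 : (k.factorial : ℚ) ≠ 0 := by positivity
    field_simp
    ring

end BinomialIdentities

section EulerPolynomials

open Polynomial in
/-- The Euler polynomial as an element of `ℚ[X]`. -/
noncomputable def eulerPolynomial (n : ℕ) : Polynomial ℚ :=
  C (2 / (n + 1 : ℚ)) * (Polynomial.bernoulli (n + 1) -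
    C (2 ^ (n + 1)) * (Polynomial.bernoulli (n + 1)).comp (C 2⁻¹ * X))

theorem eval_eulerPolynomial (n : ℕ) (x : ℚ) : (eulerPolynomial n).eval x = epoly n x := by
  simp [eulerPolynomial, epoly, bpoly, Polynomial.eval_comp, div_eq_inv_mul]

theorem bpoly_add_one (n : ℕ) (x : ℚ) : bpoly (n + 1) (x + 1) = bpoly (n + 1) x + (n + 1) * x ^ n := by
  have := Polynomial.bernoulli_eval_one_add (n + 1) x
  rw [add_comm 1 x] at this
  rw [bpoly, this, bpoly]
  push_cast
  simp

theorem epoly_add_two (n : ℕ) (x : ℚ) :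
    epoly n (x + 2) = epoly n x + 2 * ((x + 1) ^ n - x ^ n) := by
  have h1 := bpoly_add_one n x
  have h2 := bpoly_add_one n (x + 1)
  have h3 := bpoly_add_one n (x / 2)
  have h4 : (2 : ℚ) ^ (n + 1) * (x / 2) ^ n = 2 * x ^ n := by
    rw [pow_succ, div_pow]; field_simp
  rw [epoly, epoly, show x + 2 = x + 1 + 1 by ring, show (x + 1 + 1) / 2 = x / 2 + 1 by ring,
    h2, h1, h3]
  have h5 : (n + 1 : ℚ) ≠ 0 := by positivity
  field_simp
  linear_combination (-(n : ℚ) - 1) * h4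

theorem epoly_one_add_epoly_zero {n : ℕ} (hn : Even n) (hn0 : n ≠ 0) :
    epoly n 1 + epoly n 0 = 0 := by
  have hodd : (-1 : ℚ) ^ (n + 1) = -1 := hn.add_one.neg_one_pow
  have hb0 : bpoly (n + 1) 1 = bpoly (n + 1) 0 := by
    have := bpoly_add_one n 0
    simpa [hn0] using this
  have hrefl : bpoly (n + 1) 1 = -bpoly (n + 1) 0 := by
    have := Polynomial.bernoulli_eval_one_sub (n + 1) 0
    rw [sub_zero, hodd] at this
    simpa [bpoly] using this
  have hhalf : bpoly (n + 1) (1 / 2) = -bpoly (n + 1) (1 / 2) := by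
    have := Polynomial.bernoulli_eval_one_sub (n + 1) (1 / 2)
    rw [hodd, show (1 : ℚ) - 1 / 2 = 1 / 2 by norm_num] at this
    simpa [bpoly] using this
  have z0 : bpoly (n + 1) 0 = 0 := by linarith
  have z2 : bpoly (n + 1) (1 / 2) = 0 := by linarith
  simp [epoly, hb0, z0, show bpoly (n + 1) 2⁻¹ = 0 by simpa using z2]

theorem epoly_add_one_add_epoly {n : ℕ} (hn : Even n) (hn0 : n ≠ 0) (x : ℚ) :
    epoly n (x + 1) + epoly n x = 2 * x ^ n := by
  have hnat (k : ℕ) : epoly n (k + 1) + epoly n k = 2 * (k : ℚ) ^ n := by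
    induction k with
    | zero => simpa [hn0] using epoly_one_add_epoly_zero hn hn0
    | succ k ih =>
      have := epoly_add_two n k
      push_cast
      rw [show (k : ℚ) + 1 + 1 = k + 2 by ring]
      linarith
  have hpoly : (eulerPolynomial n).comp (Polynomial.X + 1) + eulerPolynomial n =
      2 * Polynomial.X ^ n := by
    refine Polynomial.eq_of_infinite_eval_eq _ _
      (Set.Infinite.mono (s := Set.range ((↑) : ℕ → ℚ)) ?_
        (Set.infinite_range_of_injective Nat.cast_injective))
    rintro _ ⟨k, rfl⟩
    have := hnat k
    simpa [Polynomial.eval_comp, eval_eulerPolynomial] using this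
  have := congrArg (Polynomial.eval x) hpoly
  simpa [Polynomial.eval_comp, eval_eulerPolynomial] using this

theorem sum_alternating_pow_eq_epoly {n : ℕ} (hn : Even n) (hn0 : n ≠ 0) (x : ℚ) (M : ℕ) :
    2 * ∑ k ∈ Finset.range M, (-1) ^ k * (x + k) ^ n =
      epoly n x - (-1) ^ M * epoly n (x + M) := by
  induction M with
  | zero => simp
  | succ M ih =>
    have h := epoly_add_one_add_epoly hn hn0 (x + M)
    rw [Finset.sum_range_succ, mul_add, ih]
    push_cast
    rw [← add_assoc, pow_succ]
    linear_combination (-(-1) ^ M) * h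

theorem eq_sum_fwdDiff_of_eq_add {f g : ℚ → ℚ} (h : f = g + (-2⁻¹ : ℚ) • fwdDiff (1 : ℚ) f)
    (J : ℕ) (x : ℚ) : f x = ∑ j ∈ Finset.range J, (-2⁻¹) ^ j * (fwdDiff (1 : ℚ))^[j] g x +
      (-2⁻¹) ^ J * (fwdDiff (1 : ℚ))^[J] f x := by
  induction J with
  | zero => simp
  | succ J ih =>
    have h' := congrFun (congrArg (fwdDiff (1 : ℚ))^[J] h) x
    rw [fwdDiff_iter_add, fwdDiff_iter_const_smul, ← Function.iterate_succ_apply] at h'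
    simp only [Pi.add_apply, Pi.smul_apply, smul_eq_mul] at h'
    rw [ih, Finset.sum_range_succ, h', pow_succ]
    ring

variable {p m : ℕ} [Fact p.Prime]

theorem fwdDiff_iter_pow_congr (n j : ℕ) {x y : ℚ} (hx : PInt p x) (hy : PInt p y)
    (h : PCong p m x y) :
    PCong p m ((fwdDiff (1 : ℚ))^[j] (fun y : ℚ => y ^ n) x)
      ((fwdDiff (1 : ℚ))^[j] (fun y : ℚ => y ^ n) y) := by
  induction j generalizing x y with
  | zero => exact h.pow hx hy n
  | succ j ih =>
    rw [Function.iterate_succ_apply', fwdDiff, fwdDiff]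
    exact (ih (hx.add PInt.one) (hy.add PInt.one) (h.add (PCong.refl 1))).sub (ih hx hy h)

theorem epoly_congr (hp2 : 2 < p) {n : ℕ} (hn : Even n) (hn0 : n ≠ 0) {x y : ℚ} (hx : PInt p x)
    (hy : PInt p y) (h : PCong p m x y) : PCong p m (epoly n x) (epoly n y) := by
  have h0 : (eulerPolynomial n).eval = (fun y : ℚ => y ^ n) +
      (-2⁻¹ : ℚ) • fwdDiff (1 : ℚ) (eulerPolynomial n).eval := by
    ext x
    have := epoly_add_one_add_epoly hn hn0 x
    simp only [Pi.add_apply, Pi.smul_apply, fwdDiff, eval_eulerPolynomial, smul_eq_mul]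
    linarith
  have e (x : ℚ) := eq_sum_fwdDiff_of_eq_add h0 ((eulerPolynomial n).natDegree + 1) x
  simp only [Polynomial.fwdDiff_iter_degree_add_one_eq_zero, Pi.zero_apply, mul_zero,
    add_zero] at e
  rw [← eval_eulerPolynomial, ← eval_eulerPolynomial, e, e]
  exact PCong.sum fun j _ =>
    (fwdDiff_iter_pow_congr n j hx hy h).const_mul ((PInt.half hp2).neg.pow j)

theorem eulerNum_congr_sum (hp2 : 2 < p) {n : ℕ} (hn : Even n) (hn0 : n ≠ 0) :
    PCong p m (eulerNum n)
      (∑ k ∈ Finset.range (p ^ m), (-1) ^ k * ((2 * k + 1 : ℕ) : ℚ) ^ n) := by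
  have hodd : Odd (p ^ m) := ((Fact.out : p.Prime).odd_of_ne_two (by omega)).pow
  have hs := sum_alternating_pow_eq_epoly hn hn0 (1 / 2) (p ^ m)
  rw [hodd.neg_one_pow] at hs
  have hhalf : PInt p (1 / 2) := by simpa using PInt.half hp2
  have hc : PCong p m (1 / 2 + (p ^ m : ℕ)) (1 / 2) := by
    have : PCong p m (((p ^ m : ℕ) : ℤ) : ℚ) ((0 : ℤ) : ℚ) := PCong.intCast (by simp)
    simpa using (PCong.refl (1 / 2)).add this
  have he := epoly_congr hp2 hn hn0 (hhalf.add (PInt.natCast _)) hhalf hc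
  have h := ((he.add (PCong.refl (epoly n (1 / 2)))).const_mul (PInt.half hp2)).const_mul
    (PInt.two.pow n)
  convert h.symm using 1
  · rw [eulerNum]; ring
  · have h2 : epoly n (1 / 2 + (p ^ m : ℕ)) + epoly n (1 / 2) =
        2 * ∑ k ∈ Finset.range (p ^ m), (-1) ^ k * ((1 / 2 : ℚ) + k) ^ n := by
      rw [hs]; ring
    rw [h2, inv_mul_cancel_left₀ two_ne_zero, Finset.mul_sum]
    refine Finset.sum_congr rfl fun k _ => ?_
    rw [mul_left_comm, ← mul_pow]
    congr 2
    push_cast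
    ring

theorem pow_congr_invSq {N : ℕ} (hN : N + 2 = (p ^ m).totient) (hmN : m ≤ N) (x : ℕ) :
    PCong p m ((x : ℚ) ^ N) (invSq p x) := by
  by_cases hx : p ∣ x
  · rw [invSq, if_pos (by exact_mod_cast hx)]
    have : PCong p m (((x : ℤ) ^ N : ℤ) : ℚ) ((0 : ℤ) : ℚ) :=
      PCong.intCast (by
        rw [sub_zero]
        exact (pow_dvd_pow _ hmN).trans (pow_dvd_pow_of_dvd (by exact_mod_cast hx) N))
    simpa using this
  · rw [invSq, if_neg (by exact_mod_cast hx)]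
    have hcop : Nat.Coprime x (p ^ m) :=
      (((Fact.out : p.Prime).coprime_iff_not_dvd.2 hx).symm).pow_right m
    have h := (Nat.modEq_iff_dvd.1 (Nat.ModEq.pow_totient hcop).symm)
    rw [← hN] at h
    have h1 : PCong p m (((x ^ (N + 2) : ℕ) : ℤ) : ℚ) ((1 : ℕ) : ℤ) :=
      PCong.intCast (by simpa using h)
    have hx0 : (x : ℚ) ≠ 0 := by
      rintro h0; exact hx (by simp [Nat.cast_eq_zero.1 h0])
    have h2 := h1.mul_const ((PInt.inv_natCast hx).pow 2)
    push_cast at h2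
    convert h2 using 1
    · rw [pow_add]; field_simp
    · push_cast; ring

end EulerPolynomials

section Congruences

variable {p m : ℕ} [Fact p.Prime]

theorem sum_alternating_invSq_congr (hp2 : 2 < p) (hm : m ≠ 0) {n : ℕ} (hn : p ^ m = 2 * n + 1)
    (hn2 : Even n) :
    PCong p m (∑ k ∈ Finset.range (p ^ m), (-1) ^ k * invSq p (2 * k + 1 : ℕ))
      (2⁻¹ * altInvSqSum p n) := by
  have h2 := not_dvd_of_pos_of_lt_prime (p := p) (c := 2) (by norm_num) hp2
  have hQ : (p : ℤ) ^ m = 2 * n + 1 := by exact_mod_cast hn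
  have hs : ∀ k, PInt p ((-1 : ℚ) ^ k) := fun k => PInt.one.neg.pow k
  have hquarter (i : ℕ) : (2⁻¹ : ℚ) ^ 2 * ((-1) ^ (i + 1) * invSq p (i + 1)) =
      (-1) ^ (i + 1) * invSq p ((2 : ℕ) * (i + 1)) := by
    rw [invSq_mul h2]; push_cast; ring
  rw [hn, show 2 * n + 1 = n + 1 + n by ring, Finset.sum_range_add, Finset.sum_range_succ]
  have hmid : invSq p (2 * n + 1 : ℕ) = 0 := by
    rw [invSq, if_pos]
    rw [← hn]
    exact_mod_cast dvd_pow_self p hm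
  rw [hmid, mul_zero, add_zero, show (2⁻¹ : ℚ) * altInvSqSum p n =
    2⁻¹ ^ 2 * altInvSqSum p n + 2⁻¹ ^ 2 * altInvSqSum p n by ring, altInvSqSum, Finset.mul_sum]
  refine PCong.add ?_ ?_
  · rw [← Finset.sum_range_reflect]
    refine PCong.sum fun i hi => ?_
    have hi := Finset.mem_range.1 hi
    obtain ⟨j, hj⟩ : ∃ j, n = i + 1 + j := ⟨n - 1 - i, by omega⟩
    have hsign : (-1 : ℚ) ^ (n - 1 - i) = (-1) ^ (i + 1) := by
      rw [show n - 1 - i = j by omega]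
      have : (-1 : ℚ) ^ (i + 1) * (-1) ^ j = 1 := by rw [← pow_add, ← hj, hn2.neg_one_pow]
      rcases neg_one_pow_eq_or ℚ (i + 1) with h | h <;> rw [h] at this ⊢ <;> linarith
    rw [hquarter, hsign]
    refine (invSq_congr_neg hm ⟨1, ?_⟩).const_mul (hs _)
    rw [hQ, show n - 1 - i = j by omega, hj]; push_cast; ring
  · refine PCong.sum fun i _ => ?_
    rw [hquarter, show n + 1 + i = n + (i + 1) by ring, pow_add, hn2.neg_one_pow, one_mul]
    refine (invSq_congr hm ⟨1, ?_⟩).const_mul (hs _)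
    rw [hQ]; push_cast; ring

theorem neg_inv_congr {r n : ℕ} (hr0 : 0 < r) (hr : ¬ p ∣ r) (hn : p ^ m = r * n + 1) :
    PCong p m (-(r : ℚ)⁻¹) n := by
  have h : PCong p m (((p ^ m : ℕ) : ℤ) : ℚ) ((0 : ℤ) : ℚ) := PCong.intCast (by simp)
  have h1 := (PCong.refl (n : ℚ)).sub (h.const_mul (PInt.inv_natCast hr))
  have hr' : (r : ℚ) ≠ 0 := by positivity
  convert h1 using 1
  · rw [hn]; push_cast; field_simp; ring
  · simp

theorem sq_eq_twenty_four_mul_add_one {p : ℕ} (hp : p.Prime) (hp3 : 3 < p) :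
    ∃ n, p ^ 2 = 24 * n + 1 := by
  have h2 : ¬ 2 ∣ p := fun h => by have := (Nat.prime_dvd_prime_iff_eq Nat.prime_two hp).1 h; omega
  have h3 : ¬ 3 ∣ p := fun h => by have := (Nat.prime_dvd_prime_iff_eq Nat.prime_three hp).1 h; omega
  have h : p ^ 2 % 24 = 1 := by
    rw [Nat.pow_mod]
    have hlt : p % 24 < 24 := Nat.mod_lt _ (by norm_num)
    have h2' : p % 24 % 2 ≠ 0 := by omega
    have h3' : p % 24 % 3 ≠ 0 := by omega
    generalize p % 24 = r at *
    interval_cases r <;> simp_all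
  exact ⟨p ^ 2 / 24, by omega⟩

theorem eulerNum_congr_altInvSqSum (hp2 : 2 < p) {N n : ℕ} (hn : p ^ 2 = 2 * n + 1) (hn2 : Even n)
    (hN2 : Even N) (hm0 : m ≠ 0) (hm : m ≤ 2) (hN : N + 2 = (p ^ m).totient) (hmN : m ≤ N) :
    PCong p m (eulerNum N) (2⁻¹ * altInvSqSum p n) := by
  have hN0 : N ≠ 0 := by omega
  refine ((eulerNum_congr_sum (m := 2) hp2 hN2 hN0).of_le hm).trans (PCong.trans ?_
    ((sum_alternating_invSq_congr (m := 2) hp2 two_ne_zero hn hn2).of_le hm))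
  exact PCong.sum fun k _ => (pow_congr_invSq hN hmN _).const_mul (PInt.one.neg.pow k)

end Congruences

section CongruencesOfSums

variable {p : ℕ} [Fact p.Prime]

theorem sum_centralBinom_sq_congr (hp2 : 2 < p) {n : ℕ} (hn : p ^ 2 = 24 * n + 1) :
    PCong p 2 (∑ k ∈ Finset.range p, (Nat.choose (2 * k) k : ℚ) ^ 2 / 16 ^ k * harm2 k)
      (-2 * altInvSqSum p (12 * n)) := by
  have h2 : ¬ p ∣ 2 := Nat.not_dvd_of_pos_of_lt (by norm_num) hp2
  have ha := neg_inv_congr (r := 2) (n := 12 * n) (by norm_num) h2 (by rw [hn]; ring)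
  have h := sum_doubleBinom_congr (c := harm2) (fun k hk => PInt.harm2 hk)
    (PInt.inv_natCast h2).neg (PInt.natCast _) ha
  have h' := h.trans (binomHarmSum_natCast_congr (12 * n))
  rw [Nat.sub_add_cancel (by omega)] at h'
  simp only [centralBinom_sq_div]
  rwa [(show Even (12 * n) from ⟨6 * n, by ring⟩).neg_one_pow, one_mul] at h'

theorem sum_choose_six_congr (hp3 : 3 < p) {n : ℕ} (hn : p ^ 2 = 24 * n + 1) :
    PCong p 2 (∑ k ∈ Finset.range p,
        (Nat.choose (6 * k) (3 * k) : ℚ) * (Nat.choose (3 * k) k) / 432 ^ k * harm2 k)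
      (-10 * altInvSqSum p (12 * n)) := by
  have hp5 : p ≠ 4 := fun h => absurd (Fact.out : p.Prime) (by rw [h]; norm_num)
  have h6 : ¬ p ∣ 6 := fun h => by
    have := Nat.le_of_dvd (by norm_num) h
    interval_cases p <;> omega
  have ha := neg_inv_congr (r := 6) (n := 4 * n) (by norm_num) h6 (by rw [hn]; ring)
  have h := sum_doubleBinom_congr (c := harm2) (fun k hk => PInt.harm2 hk)
    (PInt.inv_natCast h6).neg (PInt.natCast _) ha
  have h' := h.trans (binomHarmSum_natCast_congr (4 * n))
  rw [Nat.sub_add_cancel (by omega)] at h'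
  simp only [choose_mul_choose_div]
  rw [(show Even (4 * n) from ⟨2 * n, by ring⟩).neg_one_pow, one_mul] at h'
  have h'' := h'.trans ((altInvSqSum_sixth_congr hp3 two_ne_zero (n := 4 * n)
    (by rw [hn]; ring)).const_mul PInt.two.neg)
  convert h'' using 1
  rw [show 3 * (4 * n) = 12 * n by ring]
  ring

theorem sum_choose_four_congr (hp3 : 3 < p) {n : ℕ} (hn : p ^ 2 = 24 * n + 1) :
    PCong p 2 (1 / 4 * ∑ k ∈ Finset.range p,
        (Nat.choose (4 * k) (2 * k) : ℚ) * (Nat.choose (2 * k) k) /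
          ((2 * k + 1) * 64 ^ k) * harm2 k)
      (-2 * altInvSqSum p (12 * n)) := by
  have hp5 : p ≠ 4 := fun h => absurd (Fact.out : p.Prime) (by rw [h]; norm_num)
  have h4 : ¬ p ∣ 4 := Nat.not_dvd_of_pos_of_lt (by norm_num) (by omega)
  have ha := neg_inv_congr (r := 4) (n := 6 * n) (by norm_num) h4 (by rw [hn]; ring)
  have hint : PInt p (-((4 : ℕ) : ℚ)⁻¹) := (PInt.inv_natCast h4).neg
  have hc : ∀ k < p, PInt p (harm2 k / (2 * k + 1)) := fun k hk => PInt.harm2_div hp3 hk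
  have h := sum_doubleBinom_congr hc hint (PInt.natCast _) ha
  have hlin := ((ha.const_mul PInt.two).add (PCong.refl 1))
  have hsum : PInt p (binomHarmDivSum (p - 1) (6 * n : ℕ)) := by
    refine PInt.sum fun k hk => ?_
    have hk := Finset.mem_range.1 hk
    exact (PInt.doubleBinom (by omega) (PInt.natCast _)).mul (hc k (by omega))
  have h' := (PCong.mul ((PInt.two.mul hint).add PInt.one) hsum hlin h).trans
    (binomHarmDivSum_natCast_congr (6 * n))
  have h'' := (h'.trans ((invSqSum_quarter_congr hp3 two_ne_zero (n := 6 * n)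
    (by rw [hn]; ring)).const_mul PInt.two.neg)).const_mul (PInt.half (by omega))
  rw [Nat.sub_add_cancel (by omega)] at h''
  convert h'' using 1
  · rw [← mul_assoc]
    congr 1
    · norm_num
    · refine Finset.sum_congr rfl fun k _ => ?_
      rw [← centralBinom_mul_div, mul_comm (2 * (k : ℚ) + 1), ← div_div]
      ring
  · rw [show 2 * (6 * n) = 12 * n by ring]
    ring

theorem sum_five_congr : PCong 5 2
    (1 / 5 * ∑ k ∈ Finset.range 5,
      (Nat.choose (6 * k) (3 * k) : ℚ) * (Nat.choose (3 * k) k) / 432 ^ k * harm2 k)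
    (∑ k ∈ Finset.range 5, (Nat.choose (2 * k) k : ℚ) ^ 2 / 16 ^ k * harm2 k) := by
  have : Fact (Nat.Prime 5) := ⟨by norm_num⟩
  have h : PCong 5 2 (((5 ^ 2 : ℕ) : ℤ) : ℚ) ((0 : ℤ) : ℚ) := PCong.intCast (by simp)
  have h' := (h.mul_const (PInt.intCast (-827617021))).mul_const
    (PInt.inv_natCast (p := 5) (n := 34828517376) (by norm_num))
  rw [PCong] at h' ⊢
  convert h' using 2
  norm_num [Finset.sum_range_succ, harm2, Nat.choose]

theorem sum_choose_six_div_congr (hp3 : 3 < p) {n : ℕ} (hn : p ^ 2 = 24 * n + 1) :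
    PCong p 2 (1 / 5 * ∑ k ∈ Finset.range p,
        (Nat.choose (6 * k) (3 * k) : ℚ) * (Nat.choose (3 * k) k) / 432 ^ k * harm2 k)
      (-2 * altInvSqSum p (12 * n)) := by
  have hp5 : p ≠ 4 := fun h => absurd (Fact.out : p.Prime) (by rw [h]; norm_num)
  by_cases h : p = 5
  · subst h
    exact sum_five_congr.trans (sum_centralBinom_sq_congr (by norm_num) hn)
  · have h5 : PInt p (5 : ℚ)⁻¹ := by
      simpa using PInt.inv_natCast_of_lt (p := p) (n := 5) (by norm_num) (by omega)
    have h' := (sum_choose_six_congr hp3 hn).const_mul h5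
    convert h' using 1 <;> ring

end CongruencesOfSums

theorem stmt_14 (p : ℕ) (hp : p.Prime) (hp3 : 3 < p) :
    CongrMod p 2
      (∑ k ∈ Finset.range p, (Nat.choose (2 * k) k : ℚ) ^ 2 / 16 ^ k * harm2 k)
      (1 / 4 * ∑ k ∈ Finset.range p,
        (Nat.choose (4 * k) (2 * k) : ℚ) * (Nat.choose (2 * k) k) /
          ((2 * k + 1) * 64 ^ k) * harm2 k) ∧
    CongrMod p 2
      (1 / 4 * ∑ k ∈ Finset.range p,
        (Nat.choose (4 * k) (2 * k) : ℚ) * (Nat.choose (2 * k) k) /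
          ((2 * k + 1) * 64 ^ k) * harm2 k)
      (1 / 5 * ∑ k ∈ Finset.range p,
        (Nat.choose (6 * k) (3 * k) : ℚ) * (Nat.choose (3 * k) k) / 432 ^ k * harm2 k) ∧
    CongrMod p 2
      (1 / 5 * ∑ k ∈ Finset.range p,
        (Nat.choose (6 * k) (3 * k) : ℚ) * (Nat.choose (3 * k) k) / 432 ^ k * harm2 k)
      (-4 * eulerNum (p ^ 2 - p - 2)) ∧
    CongrMod p 1
      (∑ k ∈ Finset.range p, (Nat.choose (2 * k) k : ℚ) ^ 2 / 16 ^ k * harm2 k)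
      (-4 * eulerNum (p - 3)) ∧
    CongrMod p 1
      (1 / 4 * ∑ k ∈ Finset.range p,
        (Nat.choose (4 * k) (2 * k) : ℚ) * (Nat.choose (2 * k) k) /
          ((2 * k + 1) * 64 ^ k) * harm2 k)
      (-4 * eulerNum (p - 3)) ∧
    CongrMod p 1
      (1 / 5 * ∑ k ∈ Finset.range p,
        (Nat.choose (6 * k) (3 * k) : ℚ) * (Nat.choose (3 * k) k) / 432 ^ k * harm2 k)
      (-4 * eulerNum (p - 3)) := by
  have : Fact p.Prime := ⟨hp⟩
  have hp4 : p ≠ 4 := fun h => absurd hp (by rw [h]; norm_num)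
  obtain ⟨n, hn⟩ := sq_eq_twenty_four_mul_add_one hp hp3
  obtain ⟨r, hr⟩ := hp.odd_of_ne_two (by omega)
  have h1 := sum_centralBinom_sq_congr (by omega) hn
  have h2 := sum_choose_four_congr hp3 hn
  have h3 := sum_choose_six_div_congr hp3 hn
  have hn' : p ^ 2 = 2 * (12 * n) + 1 := by rw [hn]; ring
  have heven : Even (12 * n) := ⟨6 * n, by ring⟩
  have hsq : p ^ 2 - p - 2 + 2 = p * (p - 1) := by
    have : p * (p - 1) + p = p ^ 2 := by
      rw [← Nat.mul_succ, Nat.succ_eq_add_one, Nat.sub_add_cancel (by omega), pow_two]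
    have : 4 * 1 ≤ p * (p - 1) := Nat.mul_le_mul (by omega) (by omega)
    omega
  have hge : 4 * 4 ≤ p * (p - 1) := Nat.mul_le_mul (by omega) (by omega)
  have hpeven : Even (p * (p - 1)) := Even.mul_left ⟨r, by omega⟩ p
  have e2 := eulerNum_congr_altInvSqSum (m := 2) (N := p ^ 2 - p - 2) (by omega) hn' heven
    (by
      rw [Nat.even_iff] at hpeven ⊢
      omega)
    two_ne_zero le_rfl (by rw [hsq, Nat.totient_prime_pow hp (by norm_num)]; simp) (by omega)
  have e1 := eulerNum_congr_altInvSqSum (m := 1) (N := p - 3) (by omega) hn' heven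
    ⟨r - 1, by omega⟩ one_ne_zero one_le_two
    (by rw [pow_one, Nat.totient_prime hp]; omega) (by omega)
  have f2 := e2.const_mul (PInt.natCast 4).neg
  have f1 := e1.const_mul (PInt.natCast 4).neg
  rw [show -((4 : ℕ) : ℚ) * (2⁻¹ * altInvSqSum p (12 * n)) = -2 * altInvSqSum p (12 * n) by
    push_cast; ring, Nat.cast_ofNat] at f1 f2
  exact ⟨(h1.trans h2.symm).congrMod, (h2.trans h3.symm).congrMod, (h3.trans f2.symm).congrMod,
    ((h1.of_le one_le_two).trans f1.symm).congrMod, ((h2.of_le one_le_two).trans f1.symm).congrMod,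
    ((h3.of_le one_le_two).trans f1.symm).congrMod⟩
end

section
/- For any positive integer n and any rational number x, (1/n)·Σ_{k=1}^{n} (k² − k·x²)·C(x,k)·C(-x,k) = (n² − x²)·C(x,n)·C(-x,n). -/
open Finset

theorem gchoose_succ_mul (a : ℚ) (k : ℕ) :
    gchoose a (k + 1) * (k + 1) = gchoose a k * (a - k) := by
  have h : (Nat.factorial k : ℚ) ≠ 0 := by exact_mod_cast Nat.factorial_ne_zero k
  have h' : (k : ℚ) + 1 ≠ 0 := by positivity
  simp only [gchoose, Finset.prod_range_succ, Nat.factorial_succ, Nat.cast_mul, Nat.cast_succ]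
  field_simp

theorem sum_gchoose_mul_gchoose_neg (n : ℕ) (x : ℚ) :
    ∑ k ∈ Finset.Icc 1 n, ((k : ℚ) ^ 2 - k * x ^ 2) * gchoose x k * gchoose (-x) k =
      n * (((n : ℚ) ^ 2 - x ^ 2) * gchoose x n * gchoose (-x) n) := by
  induction n with
  | zero => simp
  | succ n ih =>
    rw [Finset.sum_Icc_succ_top (by omega), ih]
    have h₁ := gchoose_succ_mul x n
    have h₂ := gchoose_succ_mul (-x) n
    push_cast
    linear_combination (-(n : ℚ) * (gchoose (-x) (n + 1) * (n + 1))) * h₁ -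
      (n * (gchoose x n * (x - n))) * h₂

theorem stmt_17 (n : ℕ) (hn : 0 < n) (x : ℚ) :
    (1 / (n : ℚ)) *
      ∑ k ∈ Finset.Icc 1 n, ((k : ℚ) ^ 2 - k * x ^ 2) * gchoose x k * gchoose (-x) k =
      ((n : ℚ) ^ 2 - x ^ 2) * gchoose x n * gchoose (-x) n := by
  have h : (n : ℚ) ≠ 0 := by exact_mod_cast hn.ne'
  rw [sum_gchoose_mul_gchoose_neg, one_div, inv_mul_cancel_left₀ h]
end
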